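/- Let A be a smooth majority free finite idempotent algebra omitting type 1, and let C1, C2 be maximal components of Gs(A). Then there are a in C1 and b in C2 such that ab is a Mal'tsev edge of A. -/

import Mathlib

/-! Common framework: universal algebras over a fixed signature, terms,
subalgebras, congruences, quotients, edges and their types (Bulatov's
coloured-graph approach), thin edges, connectivity, products, etc. -/

/-- A (functional) signature: a type of operation symbols with arities. -/
structure Signature where
  ops : Type
  arity : ops → ℕ

/-- An algebra of a given signature. -/
structure UAlgebra (σ : Signature) where
  carrier : Type
  interp : ∀ f : σ.ops, (Fin (σ.arity f) → carrier) → carrier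

/-- Terms over the signature `σ` in `n` variables. -/
inductive Term (σ : Signature) (n : ℕ) where
  | var : Fin n → Term σ n
  | app : (f : σ.ops) → (Fin (σ.arity f) → Term σ n) → Term σ n

/-- Evaluation of a term in an algebra; term operations of an algebra are
exactly the operations of the form `Term.eval A t`. -/
def Term.eval {σ : Signature} {n : ℕ} (A : UAlgebra σ) :
    Term σ n → (Fin n → A.carrier) → A.carrier
  | .var i, x => x i
  | .app f ts, x => A.interp f fun j => Term.eval A (ts j) x

namespace UAlgebra

variable {σ : Signature}

/-- An algebra is idempotent if all its basic operations are. -/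
def Idempotent (A : UAlgebra σ) : Prop :=
  ∀ (f : σ.ops) (a : A.carrier), A.interp f (fun _ => a) = a

/-- A set closed under all basic operations. -/
def IsClosed (A : UAlgebra σ) (S : Set A.carrier) : Prop :=
  ∀ (f : σ.ops) (x : Fin (σ.arity f) → A.carrier), (∀ j, x j ∈ S) → A.interp f x ∈ S

/-- Closure of a set under the basic operations. -/
inductive Closure (A : UAlgebra σ) (S : Set A.carrier) : A.carrier → Prop
  | base {a : A.carrier} : a ∈ S → Closure A S a
  | app (f : σ.ops) (x : Fin (σ.arity f) → A.carrier) :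
      (∀ j, Closure A S (x j)) → Closure A S (A.interp f x)

def ClosureSet (A : UAlgebra σ) (S : Set A.carrier) : Set A.carrier := {x | Closure A S x}

theorem closureSet_isClosed (A : UAlgebra σ) (S : Set A.carrier) :
    A.IsClosed (A.ClosureSet S) := fun f x h => Closure.app f x h

/-- The subalgebra of `A` on a closed subset `S`. -/
def subalg (A : UAlgebra σ) (S : Set A.carrier) (hS : A.IsClosed S) : UAlgebra σ where
  carrier := {x : A.carrier // x ∈ S}
  interp f x := ⟨A.interp f fun j => (x j : A.carrier), hS f _ fun j => (x j).2⟩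

/-- The subalgebra generated by a set `S`. -/
def Sg (A : UAlgebra σ) (S : Set A.carrier) : UAlgebra σ :=
  A.subalg (A.ClosureSet S) (A.closureSet_isClosed S)

/-- `a` as an element of `Sg {a, b}`. -/
def sgA (A : UAlgebra σ) (a b : A.carrier) : (A.Sg {a, b}).carrier :=
  ⟨a, Closure.base (Set.mem_insert a {b})⟩

/-- `b` as an element of `Sg {a, b}`. -/
def sgB (A : UAlgebra σ) (a b : A.carrier) : (A.Sg {a, b}).carrier :=
  ⟨b, Closure.base (Set.mem_insert_iff.mpr (Or.inr rfl))⟩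

/-- A congruence of an algebra. -/
structure Congruence (A : UAlgebra σ) where
  rel : A.carrier → A.carrier → Prop
  refl : ∀ x, rel x x
  symm : ∀ {x y}, rel x y → rel y x
  trans : ∀ {x y z}, rel x y → rel y z → rel x z
  compat : ∀ (f : σ.ops) (x y : Fin (σ.arity f) → A.carrier),
      (∀ j, rel (x j) (y j)) → rel (A.interp f x) (A.interp f y)

def Congruence.toSetoid {A : UAlgebra σ} (θ : Congruence A) : Setoid A.carrier :=
  ⟨θ.rel, ⟨θ.refl, θ.symm, θ.trans⟩⟩

/-- The full congruence. -/
def Congruence.IsFull {A : UAlgebra σ} (θ : Congruence A) : Prop := ∀ x y, θ.rel x y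

def Congruence.le {A : UAlgebra σ} (θ η : Congruence A) : Prop :=
  ∀ x y, θ.rel x y → η.rel x y

/-- A maximal congruence: proper, and any congruence above it is full or below it. -/
def Congruence.IsMaximal {A : UAlgebra σ} (θ : Congruence A) : Prop :=
  ¬ θ.IsFull ∧ ∀ η : Congruence A, θ.le η → ¬ η.IsFull → η.le θ

/-- The quotient (factor) algebra. -/
noncomputable def quot (A : UAlgebra σ) (θ : Congruence A) : UAlgebra σ where
  carrier := Quotient θ.toSetoid
  interp f x := Quotient.mk θ.toSetoid (A.interp f fun j => (x j).out)

/-- The class of `a` in the quotient of `Sg {a,b}` by `θ`. -/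
def qa (A : UAlgebra σ) (a b : A.carrier) (θ : Congruence (A.Sg {a, b})) :
    ((A.Sg {a, b}).quot θ).carrier :=
  Quotient.mk θ.toSetoid (A.sgA a b)

def qb (A : UAlgebra σ) (a b : A.carrier) (θ : Congruence (A.Sg {a, b})) :
    ((A.Sg {a, b}).quot θ).carrier :=
  Quotient.mk θ.toSetoid (A.sgB a b)

end UAlgebra

/-- A binary operation is a semilattice operation on a set `B`. -/
def IsSemilatticeOn {α : Type} (f : α → α → α) (B : Set α) : Prop :=
  (∀ x ∈ B, f x x = x) ∧ (∀ x ∈ B, ∀ y ∈ B, f x y = f y x) ∧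
    (∀ x ∈ B, ∀ y ∈ B, ∀ z ∈ B, f x (f y z) = f (f x y) z)

/-- A ternary operation is a majority operation on a set `B`. -/
def IsMajorityOn {α : Type} (g : α → α → α → α) (B : Set α) : Prop :=
  ∀ x ∈ B, ∀ y ∈ B, g x x y = x ∧ g x y x = x ∧ g y x x = x

/-- A ternary operation is a Mal'tsev operation on a set `B`. -/
def IsMaltsevOn {α : Type} (h : α → α → α → α) (B : Set α) : Prop :=
  ∀ x ∈ B, ∀ y ∈ B, h x y y = x ∧ h y y x = x

namespace UAlgebra

variable {σ : Signature}

/-- An algebra is "a set": every term operation is a projection. -/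
def IsSetAlgebra (Q : UAlgebra σ) : Prop :=
  ∀ (n : ℕ) (t : Term σ n), ∃ i : Fin n, ∀ x : Fin n → Q.carrier, t.eval Q x = x i

/-- An algebra is the full idempotent reduct of a module over some finite ring:
its term operations are exactly the idempotent affine combinations; in
particular the affine operation `x - y + z` is a term operation. -/
def IsAffineAlgebra (Q : UAlgebra σ) : Prop :=
  ∃ (R : Type) (_ : Ring R) (_ : Finite R) (_ : AddCommGroup Q.carrier)
    (_ : Module R Q.carrier),
    (∀ (n : ℕ) (g : (Fin n → Q.carrier) → Q.carrier),
      (∃ t : Term σ n, ∀ x, t.eval Q x = g x) ↔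
      (∃ c : Fin n → R, (∑ i, c i) = 1 ∧ ∀ x, g x = ∑ i, c i • x i)) ∧
    (∃ t : Term σ 3, ∀ x y z : Q.carrier, t.eval Q ![x, y, z] = x - y + z)

/-- `θ` witnesses that `ab` is an edge of the unary type. -/
def UnaryWitness (A : UAlgebra σ) (a b : A.carrier) (θ : Congruence (A.Sg {a, b})) : Prop :=
  θ.IsMaximal ∧ IsSetAlgebra ((A.Sg {a, b}).quot θ)

/-- `θ` witnesses that `ab` is an edge of the semilattice type. -/
def SLWitness (A : UAlgebra σ) (a b : A.carrier) (θ : Congruence (A.Sg {a, b})) : Prop :=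
  θ.IsMaximal ∧ ∃ t : Term σ 2,
    IsSemilatticeOn (fun x y => t.eval ((A.Sg {a, b}).quot θ) ![x, y])
      {A.qa a b θ, A.qb a b θ}

/-- `θ` witnesses that `ab` is an edge of the majority type. -/
def MajWitness (A : UAlgebra σ) (a b : A.carrier) (θ : Congruence (A.Sg {a, b})) : Prop :=
  θ.IsMaximal ∧
  (∃ t : Term σ 3,
    IsMajorityOn (fun x y z => t.eval ((A.Sg {a, b}).quot θ) ![x, y, z])
      {A.qa a b θ, A.qb a b θ}) ∧
  ¬ (∃ t : Term σ 2,
    IsSemilatticeOn (fun x y => t.eval ((A.Sg {a, b}).quot θ) ![x, y])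
      {A.qa a b θ, A.qb a b θ})

/-- `θ` witnesses that `ab` is an edge of the affine type. -/
def AffWitness (A : UAlgebra σ) (a b : A.carrier) (θ : Congruence (A.Sg {a, b})) : Prop :=
  θ.IsMaximal ∧ IsAffineAlgebra ((A.Sg {a, b}).quot θ)

/-- A pair of distinct elements is an edge. -/
def IsEdge (A : UAlgebra σ) (a b : A.carrier) : Prop :=
  a ≠ b ∧ ∃ θ : Congruence (A.Sg {a, b}), ¬ θ.IsFull ∧
    (IsSetAlgebra ((A.Sg {a, b}).quot θ) ∨
     IsAffineAlgebra ((A.Sg {a, b}).quot θ) ∨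
     (∃ t : Term σ 2,
        IsSemilatticeOn (fun x y => t.eval ((A.Sg {a, b}).quot θ) ![x, y])
          {A.qa a b θ, A.qb a b θ}) ∨
     (∃ t : Term σ 3,
        IsMajorityOn (fun x y z => t.eval ((A.Sg {a, b}).quot θ) ![x, y, z])
          {A.qa a b θ, A.qb a b θ}))

def IsUnaryEdge (A : UAlgebra σ) (a b : A.carrier) : Prop :=
  a ≠ b ∧ ∃ θ : Congruence (A.Sg {a, b}), UnaryWitness A a b θ

def IsSLEdge (A : UAlgebra σ) (a b : A.carrier) : Prop :=
  a ≠ b ∧ ∃ θ : Congruence (A.Sg {a, b}), SLWitness A a b θ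

def IsMajEdge (A : UAlgebra σ) (a b : A.carrier) : Prop :=
  a ≠ b ∧ ∃ θ : Congruence (A.Sg {a, b}), MajWitness A a b θ

def IsAffEdge (A : UAlgebra σ) (a b : A.carrier) : Prop :=
  a ≠ b ∧ ∃ θ : Congruence (A.Sg {a, b}), AffWitness A a b θ

end UAlgebra

/-- The four types of edges. -/
inductive EdgeType where
  | unary | semilattice | majority | affine
deriving DecidableEq

namespace UAlgebra

variable {σ : Signature}

def HasEdgeOfType (A : UAlgebra σ) (τ : EdgeType) (a b : A.carrier) : Prop :=
  match τ with
  | .unary => A.IsUnaryEdge a b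
  | .semilattice => A.IsSLEdge a b
  | .majority => A.IsMajEdge a b
  | .affine => A.IsAffEdge a b

/-- `T`-restricted algebra: every edge has a type from `T`. -/
def Restricted (A : UAlgebra σ) (T : Set EdgeType) : Prop :=
  ∀ a b : A.carrier, A.IsEdge a b → ∃ τ ∈ T, A.HasEdgeOfType τ a b

/-- `A` omits type 1: no subalgebra of `A` has an edge of the unary type. -/
def OmitsType1 (A : UAlgebra σ) : Prop :=
  ∀ (S : Set A.carrier) (hS : A.IsClosed S) (a b : (A.subalg S hS).carrier),
    ¬ (A.subalg S hS).IsUnaryEdge a b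

/-- The union of the two `θ`-blocks of a thick edge, as a subset of `A`. -/
def edgeBlockUnion (A : UAlgebra σ) (a b : A.carrier) (θ : Congruence (A.Sg {a, b})) :
    Set A.carrier :=
  {x | ∃ hx : x ∈ A.ClosureSet {a, b},
    θ.rel ⟨x, hx⟩ (A.sgA a b) ∨ θ.rel ⟨x, hx⟩ (A.sgB a b)}

/-- Smooth algebra: for every semilattice- or majority-type edge with a witnessing
maximal congruence, the union of the two blocks is a subuniverse. -/
def IsSmooth (A : UAlgebra σ) : Prop :=
  ∀ (a b : A.carrier) (θ : Congruence (A.Sg {a, b})),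
    (SLWitness A a b θ ∨ MajWitness A a b θ) → A.IsClosed (A.edgeBlockUnion a b θ)

def SemilatticeFree (A : UAlgebra σ) : Prop := ∀ a b : A.carrier, ¬ A.IsSLEdge a b
def MajorityFree (A : UAlgebra σ) : Prop := ∀ a b : A.carrier, ¬ A.IsMajEdge a b
def AffineFree (A : UAlgebra σ) : Prop := ∀ a b : A.carrier, ¬ A.IsAffEdge a b

/-- Thin semilattice edge. -/
def IsThinSLEdge (A : UAlgebra σ) (a b : A.carrier) : Prop :=
  ∃ t : Term σ 2, t.eval A ![a, a] = a ∧ t.eval A ![a, b] = b ∧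
    t.eval A ![b, a] = b ∧ t.eval A ![b, b] = b

/-- Undirected thin majority edge: some term operation is majority on `{a, b}`. -/
def IsUndirThinMajEdge (A : UAlgebra σ) (a b : A.carrier) : Prop :=
  ∃ t : Term σ 3, IsMajorityOn (fun x y z => t.eval A ![x, y, z]) {a, b}

/-- Mal'tsev edge: some term operation is Mal'tsev on `{a, b}`. -/
def IsMaltsevEdge (A : UAlgebra σ) (a b : A.carrier) : Prop :=
  ∃ t : Term σ 3, IsMaltsevOn (fun x y z => t.eval A ![x, y, z]) {a, b}

/-- The class of all quotients of subalgebras of `A`. -/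
def QuotSub (A : UAlgebra σ) : Set (UAlgebra σ) :=
  {B | ∃ (S : Set A.carrier) (hS : A.IsClosed S)
        (θ : Congruence (A.subalg S hS)), B = (A.subalg S hS).quot θ}

end UAlgebra

/-- The class of all quotients of subalgebras of the algebras of a class. -/
def QuotSubClass {σ : Signature} (K : Set (UAlgebra σ)) : Set (UAlgebra σ) :=
  {B | ∃ A ∈ K, B ∈ UAlgebra.QuotSub A}

/-- A ternary term satisfies the majority condition relative to a class `𝒦`. -/
def MajorityCondition {σ : Signature} (𝒦 : Set (UAlgebra σ)) (t : Term σ 3) : Prop :=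
  (∀ B ∈ 𝒦, ∀ x y : B.carrier,
    t.eval B ![x, t.eval B ![x, y, y], t.eval B ![x, y, y]] = t.eval B ![x, y, y]) ∧
  (∀ B ∈ 𝒦, ∀ (a b : B.carrier) (θ : UAlgebra.Congruence (B.Sg {a, b})),
    a ≠ b → UAlgebra.MajWitness B a b θ →
    IsMajorityOn (fun x y z => t.eval ((B.Sg {a, b}).quot θ) ![x, y, z])
      {B.qa a b θ, B.qb a b θ})

/-- A ternary term satisfies the minority condition relative to a class `𝒦`. -/
def MinorityCondition {σ : Signature} (𝒦 : Set (UAlgebra σ)) (t : Term σ 3) : Prop :=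
  (∀ B ∈ 𝒦, ∀ x y : B.carrier,
    t.eval B ![t.eval B ![x, y, y], y, y] = t.eval B ![x, y, y]) ∧
  (∀ B ∈ 𝒦, ∀ (a b : B.carrier) (θ : UAlgebra.Congruence (B.Sg {a, b})),
    a ≠ b → UAlgebra.AffWitness B a b θ →
    IsMaltsevOn (fun x y z => t.eval ((B.Sg {a, b}).quot θ) ![x, y, z])
      {B.qa a b θ, B.qb a b θ})

/-- Thin majority edge relative to a class `𝒦`. -/
def IsThinMajEdge {σ : Signature} (𝒦 : Set (UAlgebra σ)) (A : UAlgebra σ)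
    (a b : A.carrier) : Prop :=
  ∀ t : Term σ 3, MajorityCondition 𝒦 t →
    b ∈ A.ClosureSet {a, t.eval A ![a, b, b]} ∧
    b ∈ A.ClosureSet {a, t.eval A ![b, a, b]} ∧
    b ∈ A.ClosureSet {a, t.eval A ![b, b, a]}

/-- Thin affine edge relative to a class `𝒦` (with respect to some fixed term
operation satisfying the minority condition). -/
def IsThinAffEdge {σ : Signature} (𝒦 : Set (UAlgebra σ)) (A : UAlgebra σ)
    (a b : A.carrier) : Prop :=
  (∃ t : Term σ 3, MinorityCondition 𝒦 t ∧ t.eval A ![b, a, a] = b) ∧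
  ∀ t : Term σ 3, MinorityCondition 𝒦 t → b ∈ A.ClosureSet {a, t.eval A ![a, a, b]}

namespace UAlgebra

variable {σ : Signature}

/-- Reachability in the digraph `Gs(A)` of thin semilattice edges. -/
def sReach (A : UAlgebra σ) : A.carrier → A.carrier → Prop :=
  Relation.ReflTransGen (fun x y => A.IsThinSLEdge x y)

/-- A maximal element of `Gs(A)`: an element of a maximal strongly connected
component. -/
def IsMaxElem (A : UAlgebra σ) (a : A.carrier) : Prop :=
  ∀ b, A.sReach a b → A.sReach b a

/-- A maximal component of `Gs(A)`: the strongly connected component of a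
maximal element. -/
def IsMaxComponent (A : UAlgebra σ) (C : Set A.carrier) : Prop :=
  ∃ a, A.IsMaxElem a ∧ C = {b | A.sReach a b ∧ A.sReach b a}

end UAlgebra

/-- An arc of the digraph `Gas(A)`: a thin semilattice or thin affine edge. -/
def asStep {σ : Signature} (𝒦 : Set (UAlgebra σ)) (A : UAlgebra σ)
    (x y : A.carrier) : Prop :=
  A.IsThinSLEdge x y ∨ IsThinAffEdge 𝒦 A x y

/-- Reachability in `Gas(A)`. -/
def asReach {σ : Signature} (𝒦 : Set (UAlgebra σ)) (A : UAlgebra σ) :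
    A.carrier → A.carrier → Prop :=
  Relation.ReflTransGen (asStep 𝒦 A)

/-- An as-maximal element: an element of an as-component. -/
def IsAsMaxElem {σ : Signature} (𝒦 : Set (UAlgebra σ)) (A : UAlgebra σ)
    (a : A.carrier) : Prop :=
  ∀ b, asReach 𝒦 A a b → asReach 𝒦 A b a

/-- An as-component of `A`: a maximal strongly connected component of `Gas(A)`. -/
def IsAsComponent {σ : Signature} (𝒦 : Set (UAlgebra σ)) (A : UAlgebra σ)
    (C : Set A.carrier) : Prop :=
  ∃ a, IsAsMaxElem 𝒦 A a ∧ C = {b | asReach 𝒦 A a b ∧ asReach 𝒦 A b a}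

namespace UAlgebra

variable {σ : Signature}

/-- Binary direct product. -/
def prod (A B : UAlgebra σ) : UAlgebra σ where
  carrier := A.carrier × B.carrier
  interp f x := (A.interp f fun j => (x j).1, B.interp f fun j => (x j).2)

/-- Direct product of a family. -/
def pi {ι : Type} (A : ι → UAlgebra σ) : UAlgebra σ where
  carrier := ∀ i, (A i).carrier
  interp f x := fun i => (A i).interp f fun j => x j i

/-- Homomorphism of similar algebras. -/
def IsHom (A B : UAlgebra σ) (φ : A.carrier → B.carrier) : Prop :=
  ∀ (f : σ.ops) (x : Fin (σ.arity f) → A.carrier),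
    φ (A.interp f x) = B.interp f fun j => φ (x j)

/-- Simple algebra: only the equality and full congruences. -/
def IsSimple (A : UAlgebra σ) : Prop :=
  ∀ θ : Congruence A, (∀ x y, θ.rel x y ↔ x = y) ∨ θ.IsFull

/-- Maximal generated algebra: generated by one of its maximal components. -/
def MaximalGenerated (A : UAlgebra σ) : Prop :=
  ∃ C : Set A.carrier, A.IsMaxComponent C ∧ A.ClosureSet C = Set.univ

/-- The number of subalgebras (nonempty closed subsets) of an algebra. -/
noncomputable def numSubalgebras (A : UAlgebra σ) : ℕ :=
  Nat.card {S : Set A.carrier // S.Nonempty ∧ A.IsClosed S}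

end UAlgebra

/-- A (k+3)-ary term is an edge term for a class `𝒦`. -/
def IsEdgeTermFor {σ : Signature} (𝒦 : Set (UAlgebra σ)) {k : ℕ}
    (t : Term σ (k + 3)) : Prop :=
  ∀ A ∈ 𝒦, ∀ x y : A.carrier,
    t.eval A (fun i => if i.val ≤ 1 then y else x) = x ∧
    t.eval A (fun i => if i.val = 0 ∨ i.val = 2 then y else x) = x ∧
    ∀ j : Fin (k + 3), 3 ≤ j.val →
      t.eval A (Function.update (fun _ => x) j y) = x

/-- A finite class has few subproducts. -/
def FewSubproducts {σ : Signature} (K : Set (UAlgebra σ)) : Prop :=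
  ∃ p : Polynomial ℕ, ∀ (n : ℕ) (A : Fin n → UAlgebra σ), (∀ i, A i ∈ K) →
    UAlgebra.numSubalgebras (UAlgebra.pi A) ≤ 2 ^ (p.eval n)

/-- `g_K` is bounded by a polynomial: every subalgebra of an `n`-fold product
of members of `K` has a generating set of polynomial size. -/
def PolyGenerated {σ : Signature} (K : Set (UAlgebra σ)) : Prop :=
  ∃ p : Polynomial ℕ, ∀ (n : ℕ) (A : Fin n → UAlgebra σ), (∀ i, A i ∈ K) →
    ∀ S : Set (UAlgebra.pi A).carrier, S.Nonempty → (UAlgebra.pi A).IsClosed S →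
      ∃ G : Set (UAlgebra.pi A).carrier, G ⊆ S ∧ G.Finite ∧
        G.ncard ≤ p.eval n ∧ (UAlgebra.pi A).ClosureSet G = S

namespace Term

variable {σ : Signature} {n m : ℕ}

/-- Simultaneous substitution of terms for variables. -/
def subst : Term σ n → (Fin n → Term σ m) → Term σ m
  | .var i, s => s i
  | .app f ts, s => .app f fun j => (ts j).subst s

theorem eval_subst (A : UAlgebra σ) (t : Term σ n) (s : Fin n → Term σ m)
    (x : Fin m → A.carrier) :
    (t.subst s).eval A x = t.eval A fun i => (s i).eval A x := by
  induction t with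
  | var i => rfl
  | app f ts ih =>
    simp only [subst, eval]
    congr 1
    funext j
    exact ih j

/-- A binary term applied to two terms. -/
def comp₂ (t : Term σ 2) (u v : Term σ m) : Term σ m := t.subst ![u, v]

@[simp]
theorem eval_comp₂ (A : UAlgebra σ) (t : Term σ 2) (u v : Term σ m) (x : Fin m → A.carrier) :
    (t.comp₂ u v).eval A x = t.eval A ![u.eval A x, v.eval A x] := by
  rw [comp₂, eval_subst]
  congr 1
  funext i
  fin_cases i <;> rfl

/-- The iterate `t(x, t(x, … t(x, y)))`. -/
def iter (t : Term σ 2) : ℕ → Term σ 2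
  | 0 => .var 1
  | k + 1 => t.comp₂ (.var 0) (iter t k)

theorem eval_iter (A : UAlgebra σ) (t : Term σ 2) (k : ℕ) (x y : A.carrier) :
    (t.iter k).eval A ![x, y] = (fun z => t.eval A ![x, z])^[k] y := by
  induction k with
  | zero => rfl
  | succ k ih =>
    rw [Function.iterate_succ_apply', ← ih]
    simp [iter, eval]

/-- The term `t(s(…), …, s(…))` in pairwise distinct variables. -/
def star (t : Term σ n) (s : Term σ m) : Term σ (n * m) :=
  t.subst fun j => s.subst fun i => .var (finProdFinEquiv (j, i))

theorem eval_star (A : UAlgebra σ) (t : Term σ n) (s : Term σ m)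
    (x : Fin (n * m) → A.carrier) :
    (t.star s).eval A x =
      t.eval A fun j => s.eval A fun i => x (finProdFinEquiv (j, i)) := by
  simp [star, eval_subst, eval]

end Term

namespace UAlgebra

variable {σ : Signature} {n : ℕ}

theorem Idempotent.eval_const {A : UAlgebra σ} (hid : A.Idempotent) (t : Term σ n)
    (a : A.carrier) : t.eval A (fun _ => a) = a := by
  induction t with
  | var i => rfl
  | app f ts ih =>
    simp only [Term.eval, ih]
    exact hid f a

theorem Idempotent.eval_pair {A : UAlgebra σ} (hid : A.Idempotent) (t : Term σ 2)
    (a : A.carrier) : t.eval A ![a, a] = a := by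
  convert hid.eval_const t a using 2
  funext i
  fin_cases i <;> rfl

theorem Idempotent.eval_triple {A : UAlgebra σ} (hid : A.Idempotent) (t : Term σ 3)
    (a : A.carrier) : t.eval A ![a, a, a] = a := by
  convert hid.eval_const t a using 2
  funext i
  fin_cases i <;> rfl

theorem IsClosed.eval_mem {A : UAlgebra σ} {S : Set A.carrier} (hS : A.IsClosed S)
    (t : Term σ n) {x : Fin n → A.carrier} (hx : ∀ i, x i ∈ S) : t.eval A x ∈ S := by
  induction t with
  | var i => exact hx i
  | app f ts ih => exact hS f _ ih

theorem IsClosed.eval_pair_mem {A : UAlgebra σ} {S : Set A.carrier} (hS : A.IsClosed S)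
    (t : Term σ 2) {x y : A.carrier} (hx : x ∈ S) (hy : y ∈ S) : t.eval A ![x, y] ∈ S :=
  hS.eval_mem t fun i => by fin_cases i <;> assumption

theorem IsHom.map_eval {A B : UAlgebra σ} {φ : A.carrier → B.carrier} (hφ : A.IsHom B φ)
    (t : Term σ n) (x : Fin n → A.carrier) :
    φ (t.eval A x) = t.eval B fun i => φ (x i) := by
  induction t with
  | var i => rfl
  | app f ts ih =>
    simp only [Term.eval]
    rw [hφ]
    congr 1
    funext j
    exact ih j

theorem IsHom.map_eval_pair {A B : UAlgebra σ} {φ : A.carrier → B.carrier} (hφ : A.IsHom B φ)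
    (t : Term σ 2) (x y : A.carrier) : φ (t.eval A ![x, y]) = t.eval B ![φ x, φ y] := by
  rw [hφ.map_eval]
  congr 1
  funext i
  fin_cases i <;> rfl

theorem IsHom.map_eval_triple {A B : UAlgebra σ} {φ : A.carrier → B.carrier}
    (hφ : A.IsHom B φ) (t : Term σ 3) (x y z : A.carrier) :
    φ (t.eval A ![x, y, z]) = t.eval B ![φ x, φ y, φ z] := by
  rw [hφ.map_eval]
  congr 1
  funext i
  fin_cases i <;> rfl

theorem isHom_fst (A B : UAlgebra σ) : (A.prod B).IsHom A Prod.fst := fun _ _ => rfl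

theorem isHom_snd (A B : UAlgebra σ) : (A.prod B).IsHom B Prod.snd := fun _ _ => rfl

theorem isHom_val (A : UAlgebra σ) (S : Set A.carrier) (hS : A.IsClosed S) :
    (A.subalg S hS).IsHom A Subtype.val := fun _ _ => rfl

theorem prod_idempotent {A B : UAlgebra σ} (hA : A.Idempotent) (hB : B.Idempotent) :
    (A.prod B).Idempotent := fun f a => Prod.ext (hA f a.1) (hB f a.2)

theorem closureSet_subset {A : UAlgebra σ} {S T : Set A.carrier} (hT : A.IsClosed T)
    (h : S ⊆ T) : A.ClosureSet S ⊆ T := by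
  intro x hx
  induction hx with
  | base ha => exact h ha
  | app f x _ ih => exact hT f x ih

theorem subset_closureSet (A : UAlgebra σ) (S : Set A.carrier) : S ⊆ A.ClosureSet S :=
  fun _ => Closure.base

/-- The tuples of values of an `n`-ary term at a family of points form a closed set. -/
theorem exists_term_app {A : UAlgebra σ} {κ : Type} (pts : κ → Fin n → A.carrier) (f : σ.ops)
    {v : Fin (σ.arity f) → κ → A.carrier}
    (h : ∀ j, ∃ t : Term σ n, ∀ k, t.eval A (pts k) = v j k) :
    ∃ t : Term σ n, ∀ k, t.eval A (pts k) = A.interp f fun j => v j k := by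
  choose t ht using h
  refine ⟨.app f t, fun k => ?_⟩
  simp only [Term.eval, ht]

theorem closureSet_range (A : UAlgebra σ) (v : Fin n → A.carrier) :
    A.ClosureSet (Set.range v) = {x | ∃ t : Term σ n, t.eval A v = x} := by
  apply Set.Subset.antisymm
  · refine closureSet_subset (fun f x hx => ?_) ?_
    · obtain ⟨t, ht⟩ := exists_term_app (fun _ : Unit => v) f (v := fun j _ => x j)
        (fun j => (hx j).imp fun t ht _ => ht)
      exact ⟨t, ht ()⟩
    · rintro _ ⟨i, rfl⟩
      exact ⟨.var i, rfl⟩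
  · rintro _ ⟨t, rfl⟩
    exact (A.closureSet_isClosed _).eval_mem t fun i => Closure.base ⟨i, rfl⟩

theorem mem_closureSet_pair {A : UAlgebra σ} {a b x : A.carrier} :
    x ∈ A.ClosureSet {a, b} ↔ ∃ t : Term σ 2, t.eval A ![a, b] = x := by
  have h := closureSet_range A ![a, b]
  rw [Matrix.range_cons, Matrix.range_cons, Matrix.range_empty, Set.union_empty,
    Set.singleton_union] at h
  rw [h]
  rfl

/-- Some positive iterate of a self-map of a finite set is idempotent. -/
theorem exists_iterate_idempotent {α : Type} [Finite α] (F : α → α) :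
    ∃ k, 0 < k ∧ ∀ x, F^[k] (F^[k] x) = F^[k] x := by
  obtain ⟨i, j, hij, h⟩ := Finite.exists_ne_map_eq_of_infinite fun k : ℕ => F^[k]
  wlog hlt : i < j generalizing i j
  · exact this j i hij.symm h.symm (by omega)
  obtain ⟨p, rfl⟩ := Nat.exists_eq_add_of_lt hlt
  have key : ∀ r, F^[i + r + (p + 1)] = F^[i + r] := fun r => by
    rw [show i + r + (p + 1) = r + (i + p + 1) by ring, Function.iterate_add, ← h,
      ← Function.iterate_add, add_comm]
  have key' : ∀ c r, F^[i + r + c * (p + 1)] = F^[i + r] := fun c => by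
    induction c with
    | zero => simp
    | succ c ih =>
      intro r
      rw [show i + r + (c + 1) * (p + 1) = i + (r + c * (p + 1)) + (p + 1) by ring, key,
        ← add_assoc, ih]
  refine ⟨(i + 1) * (p + 1), by positivity, fun x => ?_⟩
  rw [← Function.iterate_add_apply]
  obtain ⟨r, hr⟩ : ∃ r, (i + 1) * (p + 1) = i + r := ⟨i * p + p + 1, by ring⟩
  conv_lhs => rw [hr]
  rw [← hr, show (i + 1) * (p + 1) + (i + 1) * (p + 1) = i + r + (i + 1) * (p + 1) by omega,
    key', hr]

theorem exists_iter_idempotent (P : UAlgebra σ) [Finite P.carrier] (t : Term σ 2) :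
    ∃ k, ∀ x y, (t.iter (k + 1)).eval P ![x, (t.iter (k + 1)).eval P ![x, y]] =
      (t.iter (k + 1)).eval P ![x, y] := by
  obtain ⟨k, hk, h⟩ := exists_iterate_idempotent
    fun z : P.carrier × P.carrier => (z.1, t.eval P ![z.1, z.2])
  obtain ⟨k, rfl⟩ := Nat.exists_eq_succ_of_ne_zero hk.ne'
  have aux : ∀ l x y, (fun z : P.carrier × P.carrier => (z.1, t.eval P ![z.1, z.2]))^[l] (x, y)
      = (x, (t.iter l).eval P ![x, y]) := fun l x y => by
    induction l with
    | zero => rfl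
    | succ l ih => rw [Function.iterate_succ_apply', ih]; simp [Term.iter, Term.eval]
  refine ⟨k, fun x y => ?_⟩
  have := h (x, y)
  rw [aux, aux] at this
  exact congrArg Prod.snd this

theorem eval_iter_eq {P : UAlgebra σ} {t : Term σ 2} {x y z : P.carrier}
    (h : t.eval P ![x, y] = z) (hz : t.eval P ![x, z] = z) (k : ℕ) :
    (t.iter (k + 1)).eval P ![x, y] = z := by
  rw [Term.eval_iter, Function.iterate_succ_apply]
  simp only [h]
  exact Function.iterate_fixed hz k

/-- Every binary term `t` gives rise to a binary term `e` such that `x ≤ e(x, y)` always, and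
`e` retains the absorption properties of `t`. -/
theorem exists_thinning {P : UAlgebra σ} [Finite P.carrier] (hid : P.Idempotent)
    (t : Term σ 2) : ∃ e : Term σ 2,
      (∀ x y, P.IsThinSLEdge x (e.eval P ![x, y])) ∧
      (∀ (x : P.carrier) (Z : Set P.carrier),
        (∀ z ∈ Z, t.eval P ![x, z] ∈ Z ∧ t.eval P ![z, x] ∈ Z) →
        (∀ z ∈ Z, ∀ z' ∈ Z, t.eval P ![z, z'] ∈ Z) → ∀ z ∈ Z, e.eval P ![x, z] ∈ Z) ∧
      (∀ x y, t.eval P ![x, y] = y → e.eval P ![y, x] = y) := by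
  obtain ⟨k, hk⟩ := exists_iter_idempotent P t
  set t₁ := t.iter (k + 1) with ht₁
  set q : Term σ 2 := t₁.comp₂ (.var 0) (t₁.comp₂ (.var 1) (.var 0)) with hq
  have evq : ∀ x y, q.eval P ![x, y] = t₁.eval P ![x, t₁.eval P ![y, x]] := fun x y => by
    simp [hq, Term.eval]
  obtain ⟨l, hl⟩ := exists_iter_idempotent P q
  have key : ∀ x z, t₁.eval P ![x, z] = z → (q.iter (l + 1)).eval P ![z, x] = z :=
    fun x z h => eval_iter_eq (by rw [evq, h, hid.eval_pair]) (hid.eval_pair q z) l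
  refine ⟨q.iter (l + 1), fun x y => ⟨q.iter (l + 1), hid.eval_pair _ _, hl x y, ?_,
    hid.eval_pair _ _⟩, fun x Z hZ hZZ z hz => ?_, fun x y h => ?_⟩
  · apply key
    rw [Term.eval_iter P q, Function.iterate_succ_apply', evq, hk]
  · have h₁ : ∀ z ∈ Z, ∀ j, (t.iter j).eval P ![x, z] ∈ Z := fun z hz j => by
      induction j with
      | zero => exact hz
      | succ j ih => simpa [Term.iter, Term.eval] using (hZ _ ih).1
    have h₂ : ∀ z ∈ Z, ∀ j, (t.iter (j + 1)).eval P ![z, x] ∈ Z := fun z hz j => by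
      induction j with
      | zero => simpa [Term.iter, Term.eval] using (hZ _ hz).2
      | succ j ih =>
        have := hZZ _ hz _ ih
        rw [Term.iter]
        simpa [Term.eval] using this
    have h₃ : ∀ j, (q.iter j).eval P ![x, z] ∈ Z := fun j => by
      induction j with
      | zero => exact hz
      | succ j ih =>
        rw [Term.iter]
        simp only [Term.eval_comp₂, evq]
        exact h₁ _ (h₂ _ ih k) _
    exact h₃ _
  · exact key x y (eval_iter_eq h h k)

theorem IsThinSLEdge.exists_term {P : UAlgebra σ} [Finite P.carrier] (hid : P.Idempotent)
    {x y : P.carrier} (h : P.IsThinSLEdge x y) : ∃ e : Term σ 2,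
      (∀ u v, P.IsThinSLEdge u (e.eval P ![u, v])) ∧ e.eval P ![x, y] = y ∧
      e.eval P ![y, x] = y := by
  obtain ⟨t, -, h₁, h₂, h₃⟩ := h
  obtain ⟨e, he, heZ, he'⟩ := exists_thinning hid t
  refine ⟨e, he, ?_, he' x y h₁⟩
  have := heZ x {y} (by simp [h₁, h₂]) (by simp [h₃]) y rfl
  simpa using this

theorem IsThinSLEdge.map {P Q : UAlgebra σ} {φ : P.carrier → Q.carrier} (hφ : P.IsHom Q φ)
    {x y : P.carrier} (h : P.IsThinSLEdge x y) : Q.IsThinSLEdge (φ x) (φ y) := by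
  obtain ⟨t, h₀, h₁, h₂, h₃⟩ := h
  have key := fun a b => (hφ.map_eval_pair t a b).symm
  exact ⟨t, by rw [key, h₀], by rw [key, h₁], by rw [key, h₂], by rw [key, h₃]⟩

/-- Reachability along thin semilattice edges inside a set `B`. -/
def ReachIn (P : UAlgebra σ) (B : Set P.carrier) : P.carrier → P.carrier → Prop :=
  Relation.ReflTransGen fun x y => P.IsThinSLEdge x y ∧ y ∈ B

/-- An element of `B` that is maximal with respect to reachability inside `B`. -/
def MaxIn (P : UAlgebra σ) (B : Set P.carrier) (m : P.carrier) : Prop :=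
  m ∈ B ∧ ∀ c, P.ReachIn B m c → P.ReachIn B c m

theorem ReachIn.mem {P : UAlgebra σ} {B : Set P.carrier} {x y : P.carrier} (hx : x ∈ B)
    (h : P.ReachIn B x y) : y ∈ B := by
  induction h with
  | refl => exact hx
  | tail _ h _ => exact h.2

theorem ReachIn.mono {P : UAlgebra σ} {B B' : Set P.carrier} (hB : B ⊆ B') {x y : P.carrier}
    (h : P.ReachIn B x y) : P.ReachIn B' x y :=
  Relation.ReflTransGen.mono (fun _ _ h => ⟨h.1, hB h.2⟩) _ _ h

theorem ReachIn.sReach {P : UAlgebra σ} {B : Set P.carrier} {x y : P.carrier}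
    (h : P.ReachIn B x y) : P.sReach x y :=
  Relation.ReflTransGen.mono (fun _ _ h => h.1) _ _ h

theorem exists_maxIn {P : UAlgebra σ} [Finite P.carrier] {B : Set P.carrier} {x : P.carrier}
    (hx : x ∈ B) : ∃ m, P.ReachIn B x m ∧ P.MaxIn B m := by
  obtain ⟨m, hm, hmin⟩ := Set.exists_min_image {m | P.ReachIn B x m}
    (fun m => {c | P.ReachIn B m c}.ncard) (Set.toFinite _) ⟨x, Relation.ReflTransGen.refl⟩
  refine ⟨m, hm, ReachIn.mem hx hm, fun c hc => ?_⟩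
  have hsub : {d | P.ReachIn B c d} ⊆ {d | P.ReachIn B m d} := fun d hd => hc.trans hd
  have := Set.eq_of_subset_of_ncard_le hsub (hmin c (hm.trans hc)) (Set.toFinite _)
  have hmm : m ∈ {d | P.ReachIn B m d} := Relation.ReflTransGen.refl
  rw [← this] at hmm
  exact hmm

theorem MaxIn.of_reachIn {P : UAlgebra σ} {B : Set P.carrier} {x y : P.carrier}
    (hx : P.MaxIn B x) (h : P.ReachIn B x y) : P.MaxIn B y :=
  ⟨h.mem hx.1, fun _ hc => (hx.2 _ (h.trans hc)).trans h⟩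

/-- A nonempty subuniverse `Y` of `B` which absorbs `B` and is closed under thin semilattice
edges inside `B`. -/
structure AbsorbsUp (P : UAlgebra σ) (B Y : Set P.carrier) : Prop where
  subset : Y ⊆ B
  nonempty : Y.Nonempty
  closed : P.IsClosed Y
  absorbs : ∃ (n : ℕ) (s : Term σ n), ∀ x : Fin n → P.carrier, (∀ j, x j ∈ B) →
    ∀ i, (∀ j, j ≠ i → x j ∈ Y) → s.eval P x ∈ Y
  up : ∀ x ∈ Y, ∀ y ∈ B, P.IsThinSLEdge x y → y ∈ Y

theorem AbsorbsUp.reachIn {P : UAlgebra σ} {B Y : Set P.carrier} (hY : P.AbsorbsUp B Y)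
    {x y : P.carrier} (hx : x ∈ Y) (h : P.ReachIn B x y) : y ∈ Y := by
  induction h with
  | refl => exact hx
  | tail _ h ih => exact hY.up _ ih _ h.2 h.1

end UAlgebra

namespace UAlgebra

variable {σ : Signature} {n : ℕ}

/-- The values at `p` of the terms whose values at the points `q k` lie in the sets `Z k`. -/
def valuesAt (P : UAlgebra σ) {κ : Type} (p : Fin n → P.carrier) (q : κ → Fin n → P.carrier)
    (Z : κ → Set P.carrier) : Set P.carrier :=
  {b | ∃ t : Term σ n, t.eval P p = b ∧ ∀ k, t.eval P (q k) ∈ Z k}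

theorem isClosed_valuesAt {P : UAlgebra σ} {κ : Type} (p : Fin n → P.carrier)
    (q : κ → Fin n → P.carrier) {Z : κ → Set P.carrier} (hZ : ∀ k, P.IsClosed (Z k)) :
    P.IsClosed (P.valuesAt p q Z) := by
  intro f x hx
  choose t ht htZ using hx
  refine ⟨.app f t, by simp only [Term.eval, ht], fun k => hZ k f _ fun j => htZ j k⟩

theorem Idempotent.isClosed_singleton {P : UAlgebra σ} (hid : P.Idempotent) (a : P.carrier) :
    P.IsClosed {a} := by
  intro f x hx
  obtain rfl : x = fun _ => a := funext hx
  exact hid f a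

theorem isClosed_inter {P : UAlgebra σ} {S T : Set P.carrier} (hS : P.IsClosed S)
    (hT : P.IsClosed T) : P.IsClosed (S ∩ T) :=
  fun f x hx => ⟨hS f x fun j => (hx j).1, hT f x fun j => (hx j).2⟩

theorem AbsorbsUp.valuesAt {P : UAlgebra σ} [Finite P.carrier] (hid : P.Idempotent)
    {B Y : Set P.carrier} (hB : P.IsClosed B) (hY : P.AbsorbsUp B Y) {κ : Type}
    {p : Fin n → P.carrier} {q : κ → Fin n → P.carrier}
    (hp : B = {b | ∃ t : Term σ n, t.eval P p = b}) (hq : ∀ k i, q k i ∈ B)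
    (hne : (P.valuesAt p q fun _ => Y).Nonempty) :
    P.AbsorbsUp B (P.valuesAt p q fun _ => Y) where
  subset := by
    rintro _ ⟨t, rfl, -⟩
    rw [hp]
    exact ⟨t, rfl⟩
  nonempty := hne
  closed := isClosed_valuesAt p q fun _ => hY.closed
  absorbs := by
    obtain ⟨l, s, hs⟩ := hY.absorbs
    refine ⟨l, s, fun x hx i hi => ?_⟩
    have : ∀ j, ∃ t : Term σ n, t.eval P p = x j ∧ (j ≠ i → ∀ k, t.eval P (q k) ∈ Y) := by
      intro j
      by_cases hj : j = i
      · have hxj := hx j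
        rw [hp] at hxj
        obtain ⟨t, ht⟩ := hxj
        exact ⟨t, ht, fun h => absurd hj h⟩
      · obtain ⟨t, ht, ht'⟩ := hi j hj
        exact ⟨t, ht, fun _ => ht'⟩
    choose t ht htY using this
    refine ⟨s.subst t, by simp only [Term.eval_subst, ht], fun k => ?_⟩
    rw [Term.eval_subst]
    exact hs _ (fun j => hB.eval_mem _ (hq k)) i fun j hj => htY j hj k
  up := by
    rintro x ⟨t, ht, htY⟩ y hy hxy
    rw [hp] at hy
    obtain ⟨u, hu⟩ := hy
    obtain ⟨e, he, hexy, -⟩ := hxy.exists_term hid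
    refine ⟨e.comp₂ t u, by rw [Term.eval_comp₂, ht, hu, hexy], fun k => ?_⟩
    rw [Term.eval_comp₂]
    exact hY.up _ (htY k) _ (hB.eval_pair_mem e (hB.eval_mem _ (hq k)) (hB.eval_mem _ (hq k)))
      (he _ _)

/-- The pairs `(u(y, m), u(m, y))`. -/
def Link (P : UAlgebra σ) (y m b c : P.carrier) : Prop :=
  ∃ u : Term σ 2, u.eval P ![y, m] = b ∧ u.eval P ![m, y] = c

section Link

variable {P : UAlgebra σ} {y m : P.carrier}

theorem link_self (y m : P.carrier) : P.Link y m y m := ⟨.var 0, rfl, rfl⟩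

theorem Link.swap {b c : P.carrier} (h : P.Link y m b c) : P.Link m y c b := by
  obtain ⟨u, hb, hc⟩ := h
  exact ⟨u, hc, hb⟩

theorem Link.symm {b c : P.carrier} (h : P.Link y m b c) : P.Link y m c b := by
  obtain ⟨u, hb, hc⟩ := h
  exact ⟨u.comp₂ (.var 1) (.var 0), by simpa [Term.eval] using hc,
    by simpa [Term.eval] using hb⟩

theorem Link.app (f : σ.ops) {x z : Fin (σ.arity f) → P.carrier}
    (h : ∀ j, P.Link y m (x j) (z j)) : P.Link y m (P.interp f x) (P.interp f z) := by
  choose u hx hz using h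
  exact ⟨.app f u, by simp only [Term.eval, hx], by simp only [Term.eval, hz]⟩

theorem exists_link {b : P.carrier} (h : b ∈ P.ClosureSet {y, m}) : ∃ c, P.Link y m b c := by
  obtain ⟨u, hu⟩ := mem_closureSet_pair.1 h
  exact ⟨_, u, hu, rfl⟩

/-- The elements linked to an element of `Z`. -/
def linkSet (P : UAlgebra σ) (y m : P.carrier) (Z : Set P.carrier) : Set P.carrier :=
  P.valuesAt ![m, y] (fun _ : Unit => ![y, m]) fun _ => Z

theorem mem_linkSet {Z : Set P.carrier} {c : P.carrier} :
    c ∈ P.linkSet y m Z ↔ ∃ b ∈ Z, P.Link y m b c := by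
  constructor
  · rintro ⟨u, hu, hZ⟩
    exact ⟨_, hZ (), u, rfl, hu⟩
  · rintro ⟨_, hb, u, rfl, hu⟩
    exact ⟨u, hu, fun _ => hb⟩

theorem isClosed_linkSet {Z : Set P.carrier} (hZ : P.IsClosed Z) :
    P.IsClosed (P.linkSet y m Z) :=
  isClosed_valuesAt _ _ fun _ => hZ

theorem AbsorbsUp.linkSet [Finite P.carrier] (hid : P.Idempotent)
    {Y : Set P.carrier} (hY : P.AbsorbsUp (P.ClosureSet {y, m}) Y) :
    P.AbsorbsUp (P.ClosureSet {y, m}) (P.linkSet y m Y) := by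
  refine hY.valuesAt hid (P.closureSet_isClosed _) ?_ ?_ ?_
  · rw [Set.pair_comm]
    ext b
    exact mem_closureSet_pair
  · intro _ i
    fin_cases i <;> exact subset_closureSet _ _ (by simp)
  · obtain ⟨b, hb⟩ := hY.nonempty
    obtain ⟨c, hc⟩ := exists_link (hY.subset hb)
    exact ⟨c, mem_linkSet.2 ⟨b, hb, hc⟩⟩

end Link

/-- Every absorbing up-closed subuniverse generates `B` together with any maximal element
outside of it. -/
def Spans (P : UAlgebra σ) (B : Set P.carrier) : Prop :=
  ∀ Y, P.AbsorbsUp B Y → ∀ y ∈ Y, ∀ m, P.MaxIn B m → m ∉ Y → P.ClosureSet {y, m} = B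

theorem AbsorbsUp.not_link {P : UAlgebra σ} (hid : P.Idempotent) {B Y : Set P.carrier}
    (hG : P.Spans B) (hY : P.AbsorbsUp B Y) {y m : P.carrier} (hy : y ∈ Y) (hm : P.MaxIn B m)
    (hmY : m ∉ Y) {y₁ y₂ : P.carrier} (h₁ : y₁ ∈ Y) (h₂ : y₂ ∈ Y) : ¬ P.Link y m y₁ y₂ := by
  intro h
  have sub : ∀ {Z : Set P.carrier}, P.IsClosed Z → m ∈ Z → ∀ y' ∈ Y, y' ∈ Z → y ∈ Z :=
    fun hZ hmZ y' hy' hy'Z => by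
      have := hG Y hY y' hy' m hm hmY
      have hle := closureSet_subset (S := {y', m}) hZ (by
        rintro _ (rfl | rfl) <;> assumption)
      rw [this] at hle
      exact hle (hY.subset hy)
  obtain ⟨y', hy', hl⟩ := mem_linkSet.1 <| sub (isClosed_linkSet hY.closed)
    (mem_linkSet.2 ⟨y, hy, link_self y m⟩) y₂ h₂ (mem_linkSet.2 ⟨y₁, h₁, h⟩)
  obtain ⟨y'', rfl, u, hu₁, hu₂⟩ := mem_linkSet.1 <| sub
    (isClosed_linkSet (hid.isClosed_singleton y))
    (mem_linkSet.2 ⟨y, rfl, link_self y m⟩) y' hy' (mem_linkSet.2 ⟨y, rfl, hl.symm⟩)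
  have hthin : P.IsThinSLEdge m y'' := ⟨u, hid.eval_pair u m, hu₂, hu₁, hid.eval_pair u y''⟩
  exact hmY (hY.reachIn hy (hm.2 _ (.single ⟨hthin, hY.subset hy⟩)))

end UAlgebra

namespace UAlgebra

variable {σ : Signature} {n : ℕ}

theorem isHom_mk {Q : UAlgebra σ} (θ : Congruence Q) :
    Q.IsHom (Q.quot θ) (Quotient.mk θ.toSetoid) := by
  intro f x
  refine Quotient.sound (s := θ.toSetoid) (θ.compat f _ _ fun j => ?_)
  exact θ.symm (Quotient.mk_out (s := θ.toSetoid) (x j))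

theorem Congruence.mk_eq_mk {Q : UAlgebra σ} (θ : Congruence Q) {x y : Q.carrier} :
    Quotient.mk θ.toSetoid x = Quotient.mk θ.toSetoid y ↔ θ.rel x y :=
  ⟨fun h => Quotient.exact h, fun h => Quotient.sound h⟩

theorem Congruence.eval_mk {Q : UAlgebra σ} (θ : Congruence Q) (t : Term σ n)
    (x : Fin n → Q.carrier) :
    t.eval (Q.quot θ) (fun i => Quotient.mk θ.toSetoid (x i)) =
      Quotient.mk θ.toSetoid (t.eval Q x) :=
  ((isHom_mk θ).map_eval t x).symm

theorem Congruence.eval_mk_pair {Q : UAlgebra σ} (θ : Congruence Q) (t : Term σ 2)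
    (x y : Q.carrier) :
    t.eval (Q.quot θ) ![Quotient.mk θ.toSetoid x, Quotient.mk θ.toSetoid y] =
      Quotient.mk θ.toSetoid (t.eval Q ![x, y]) :=
  ((isHom_mk θ).map_eval_pair t x y).symm

theorem Congruence.eval_mk_triple {Q : UAlgebra σ} (θ : Congruence Q) (t : Term σ 3)
    (x y z : Q.carrier) :
    t.eval (Q.quot θ) ![Quotient.mk θ.toSetoid x, Quotient.mk θ.toSetoid y,
      Quotient.mk θ.toSetoid z] = Quotient.mk θ.toSetoid (t.eval Q ![x, y, z]) :=
  ((isHom_mk θ).map_eval_triple t x y z).symm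

/-- The transitive closure of a reflexive, symmetric and compatible relation. -/
def Congruence.ofTolerance {Q : UAlgebra σ} (T : Q.carrier → Q.carrier → Prop)
    (hrefl : ∀ x, T x x) (hsymm : ∀ x y, T x y → T y x)
    (hT : ∀ (f : σ.ops) (x y : Fin (σ.arity f) → Q.carrier), (∀ j, T (x j) (y j)) →
      T (Q.interp f x) (Q.interp f y)) : Congruence Q where
  rel := Relation.ReflTransGen T
  refl _ := .refl
  symm h := by
    induction h with
    | refl => exact .refl
    | tail _ h ih => exact .head (hsymm _ _ h) ih
  trans h h' := h.trans h'
  compat f x y h := by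
    classical
    have key : ∀ s : Finset (Fin (σ.arity f)), Relation.ReflTransGen T (Q.interp f x)
        (Q.interp f fun j => if j ∈ s then y j else x j) := by
      intro s
      induction s using Finset.induction with
      | empty => simpa using Relation.ReflTransGen.refl
      | insert a s ha ih =>
        refine ih.trans ?_
        have := Relation.ReflTransGen.lift (r := T) (p := T)
          (fun w => Q.interp f (Function.update (fun j => if j ∈ s then y j else x j) a w))
          (fun u v huv => hT f _ _ fun j => by
            by_cases hj : j = a
            · subst hj
              simpa using huv
            · simpa [hj] using hrefl _) _ _ (h a)
        convert this using 2
        · funext j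
          by_cases hj : j = a
          · subst hj
            simp [ha]
          · simp [hj]
        · funext j
          by_cases hj : j = a
          · subst hj
            simp
          · simp [hj]
    simpa using key Finset.univ

theorem Congruence.exists_isMaximal {Q : UAlgebra σ} [Finite Q.carrier] (θ₀ : Congruence Q)
    (h₀ : ¬ θ₀.IsFull) : ∃ θ : Congruence Q, θ₀.le θ ∧ θ.IsMaximal := by
  obtain ⟨R, ⟨θ, hle, hfull, rfl⟩, hmax⟩ := Set.exists_max_image
    {R : Set (Q.carrier × Q.carrier) | ∃ θ : Congruence Q, θ₀.le θ ∧ ¬ θ.IsFull ∧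
      R = {p | θ.rel p.1 p.2}} Set.ncard (Set.toFinite _)
    ⟨_, θ₀, fun _ _ h => h, h₀, rfl⟩
  refine ⟨θ, hle, hfull, fun η hη hηfull x y hxy => ?_⟩
  have := Set.eq_of_subset_of_ncard_le (s := {p : Q.carrier × Q.carrier | θ.rel p.1 p.2})
    (t := {p : Q.carrier × Q.carrier | η.rel p.1 p.2}) (fun p hp => hη _ _ hp)
    (hmax _ ⟨η, fun _ _ h => hη _ _ (hle _ _ h), hηfull, rfl⟩) (Set.toFinite _)
  have hmem : (x, y) ∈ {p : Q.carrier × Q.carrier | η.rel p.1 p.2} := hxy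
  rw [← this] at hmem
  exact hmem

theorem subalg_idempotent {P : UAlgebra σ} (hid : P.Idempotent) (S : Set P.carrier)
    (hS : P.IsClosed S) : (P.subalg S hS).Idempotent :=
  fun f a => Subtype.ext (hid f a.1)

theorem quot_idempotent {Q : UAlgebra σ} (hid : Q.Idempotent) (θ : Congruence Q) :
    (Q.quot θ).Idempotent := by
  intro f a
  obtain ⟨a, rfl⟩ := Quotient.exists_rep a
  rw [← isHom_mk θ f fun _ => a, hid]

theorem isMajorityOn_pair {α : Type} {g : α → α → α → α} {a b : α} (ha : g a a a = a)
    (hb : g b b b = b) (haab : g a a b = a) (haba : g a b a = a) (hbaa : g b a a = a)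
    (hbba : g b b a = b) (hbab : g b a b = b) (habb : g a b b = b) :
    IsMajorityOn g {a, b} := by
  rintro x (rfl | rfl) y (rfl | rfl) <;> simp only [*, and_self]

end UAlgebra

namespace UAlgebra

variable {σ : Signature}

theorem closureSet_eq_values {P : UAlgebra σ} {n : ℕ} {y m : P.carrier}
    {p : Fin n → P.carrier} (hp : ∀ i, p i = y ∨ p i = m) (hy : ∃ i, p i = y)
    (hm : ∃ i, p i = m) :
    P.ClosureSet {y, m} = {b | ∃ t : Term σ n, t.eval P p = b} := by
  rw [← closureSet_range]
  congr 1
  ext b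
  constructor
  · rintro (rfl | rfl)
    exacts [hy, hm]
  · rintro ⟨i, rfl⟩
    exact hp i

theorem mem_closureSet_of_eq_or {P : UAlgebra σ} {y m b : P.carrier} (h : b = y ∨ b = m) :
    b ∈ P.ClosureSet {y, m} :=
  subset_closureSet _ _ h

/-- Some `n`-ary term takes values in `Y` on every tuple having one entry `m` and all other
entries `y`. -/
def Hits (P : UAlgebra σ) (Y : Set P.carrier) (y m : P.carrier) (n : ℕ) : Prop :=
  ∃ t : Term σ n, ∀ i, t.eval P (Function.update (fun _ => y) i m) ∈ Y

theorem update_eq_or {α : Type} {n : ℕ} (y m : α) (i j : Fin n) :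
    Function.update (fun _ => y) i m j = y ∨ Function.update (fun _ => y) i m j = m := by
  by_cases h : j = i
  · subst h
    simp
  · simp [h]

theorem update_succ_zero {α : Type} {n : ℕ} (y m : α) (i : Fin n) :
    Function.update (fun _ => y) i.succ m 0 = y :=
  Function.update_of_ne (Fin.succ_ne_zero i).symm _ _

theorem update_succ_succ {α : Type} {n : ℕ} (y m : α) (i j : Fin n) :
    Function.update (fun _ => y) i.succ m j.succ = Function.update (fun _ => y) i m j := by
  simp only [Function.update_apply, Fin.succ_inj]

section

variable {P : UAlgebra σ} {Y : Set P.carrier} {y m : P.carrier}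

theorem AbsorbsUp.not_hits_two (hid : P.Idempotent)
    (hG : P.Spans (P.ClosureSet {y, m})) (hY : P.AbsorbsUp (P.ClosureSet {y, m}) Y)
    (hy : y ∈ Y) (hm : P.MaxIn (P.ClosureSet {y, m}) m) (hmY : m ∉ Y) :
    ¬ P.Hits Y y m 2 := by
  rintro ⟨t, ht⟩
  have e₀ : Function.update (fun _ => y) (0 : Fin 2) m = ![m, y] := by
    funext i
    fin_cases i <;> rfl
  have e₁ : Function.update (fun _ => y) (1 : Fin 2) m = ![y, m] := by
    funext i
    fin_cases i <;> rfl
  have h₀ := ht 0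
  have h₁ := ht 1
  rw [e₀] at h₀
  rw [e₁] at h₁
  exact hY.not_link hid hG hy hm hmY h₁ h₀ ⟨t, rfl, rfl⟩

theorem AbsorbsUp.hits_three_of_hits [Finite P.carrier] (hid : P.Idempotent)
    (hG : P.Spans (P.ClosureSet {y, m})) (hY : P.AbsorbsUp (P.ClosureSet {y, m}) Y)
    (hy : y ∈ Y) (hstab : P.linkSet y m (P.linkSet y m Y) = Y) {k : ℕ}
    (hk : P.Hits Y y m (k + 4)) (hk' : ¬ P.Hits Y y m (k + 3)) : P.Hits Y y m 3 := by
  obtain ⟨t, ht⟩ := hk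
  set b := t.eval P (Fin.cons m (Function.update (fun _ => y) 0 m)) with hb
  set p : Fin (k + 3) → P.carrier := Function.update (fun _ => y) 0 m with hp
  set q : Fin (k + 2) → Fin (k + 3) → P.carrier :=
    fun i => Function.update (fun _ => y) i.succ m with hq
  have hbE : b ∈ P.valuesAt p q fun _ => Y := by
    refine ⟨t.subst (Fin.cons (.var 0) .var), ?_, fun i => ?_⟩
    · rw [Term.eval_subst, hb]
      congr 1
      funext j
      refine Fin.cases ?_ (fun j => ?_) j
      · simp [Term.eval, hp]
      · simp [Term.eval]
    · rw [Term.eval_subst]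
      convert ht i.succ.succ using 2
      funext j
      refine Fin.cases ?_ (fun j => ?_) j
      · rw [update_succ_zero]
        exact update_succ_zero y m i
      · rw [update_succ_succ]
        rfl
  have hE : P.AbsorbsUp (P.ClosureSet {y, m}) (P.valuesAt p q fun _ => Y) :=
    hY.valuesAt hid (P.closureSet_isClosed _)
      (closureSet_eq_values (update_eq_or y m 0) ⟨1, by simp [hp]⟩ ⟨0, by simp [hp]⟩)
      (fun i j => mem_closureSet_of_eq_or (update_eq_or y m i.succ j)) ⟨b, hbE⟩
  have hmE : m ∈ P.valuesAt p q fun _ => Y :=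
    ⟨.var 0, by simp [Term.eval, hp], fun i => by
      change Function.update (fun _ => y) i.succ m 0 ∈ Y
      rw [update_succ_zero]
      exact hy⟩
  have hyE : y ∉ P.valuesAt p q fun _ => Y := by
    rintro ⟨u, hu, huq⟩
    refine hk' ⟨u, Fin.cases ?_ huq⟩
    rw [← hp, hu]
    exact hy
  obtain ⟨c, hbc, hc⟩ := exists_maxIn (hE.subset hbE)
  have hcE := hE.reachIn hbE hbc
  have hcL : c ∈ P.linkSet y m Y := by
    by_contra hcL
    have := hG _ (hY.linkSet hid) m (mem_linkSet.2 ⟨y, hy, link_self y m⟩) c hc hcL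
    have hle := closureSet_subset (S := {m, c}) hE.closed (by
      rintro _ (rfl | rfl) <;> assumption)
    rw [this] at hle
    exact hyE (hle (hY.subset hy))
  have hV : P.AbsorbsUp (P.ClosureSet {y, m})
      (P.valuesAt ![m, m, y] ![![m, y, y], ![y, m, y]] fun _ => Y) ∧
      b ∈ P.valuesAt ![m, m, y] ![![m, y, y], ![y, m, y]] fun _ => Y := by
    have hbV : b ∈ P.valuesAt ![m, m, y] ![![m, y, y], ![y, m, y]] fun _ => Y := by
      refine ⟨t.subst (Fin.cons (.var 0) (Fin.cons (.var 1) fun _ => .var 2)), ?_, fun i => ?_⟩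
      · rw [Term.eval_subst, hb]
        congr 1
        funext j
        refine Fin.cases ?_ (fun j => Fin.cases ?_ (fun j => ?_) j) j
        · simp [Term.eval]
        · simp [Term.eval, hp]
        · simp [Term.eval, hp]
      · rw [Term.eval_subst]
        have h₀ := ht 0
        have h₁ := ht (Fin.succ 0)
        fin_cases i
        · convert h₀ using 2
          funext j
          refine Fin.cases ?_ (fun j => Fin.cases ?_ (fun j => ?_) j) j
          · simp [Term.eval]
          · simp [Term.eval]
          · simp [Term.eval]
        · convert h₁ using 2
          funext j
          refine Fin.cases ?_ (fun j => Fin.cases ?_ (fun j => ?_) j) j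
          · rw [update_succ_zero]
            rfl
          · rw [update_succ_succ]
            simp [Term.eval]
          · rw [update_succ_succ]
            simp [Term.eval]
    refine ⟨hY.valuesAt hid (P.closureSet_isClosed _) (closureSet_eq_values ?_ ⟨2, rfl⟩ ⟨0, rfl⟩)
      (fun i j => mem_closureSet_of_eq_or ?_) ⟨b, hbV⟩, hbV⟩
    · intro i
      fin_cases i <;> simp
    · fin_cases i <;> fin_cases j <;> simp
  obtain ⟨g, hg, hgY⟩ := hV.1.reachIn hV.2 hbc
  have hlast : g.eval P ![y, y, m] ∈ Y := by
    rw [← hstab]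
    refine mem_linkSet.2 ⟨c, hcL, Link.symm ⟨g.subst ![.var 0, .var 0, .var 1], ?_, ?_⟩⟩
    · rw [Term.eval_subst]
      congr 1
      funext i
      fin_cases i <;> rfl
    · rw [Term.eval_subst, ← hg]
      congr 1
      funext i
      fin_cases i <;> rfl
  refine ⟨g, fun i => ?_⟩
  have h₀ := hgY 0
  have h₁ := hgY 1
  fin_cases i
  · convert h₀ using 2
    funext i
    fin_cases i <;> rfl
  · convert h₁ using 2
    funext i
    fin_cases i <;> rfl
  · convert hlast using 2
    funext i
    fin_cases i <;> rfl

/-- If a closed set contains `m` and meets `Y`, then it contains `y`. -/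
theorem AbsorbsUp.mem_of_meets
    (hG : P.Spans (P.ClosureSet {y, m})) (hY : P.AbsorbsUp (P.ClosureSet {y, m}) Y)
    (hy : y ∈ Y) (hm : P.MaxIn (P.ClosureSet {y, m}) m) (hmY : m ∉ Y) {V : Set P.carrier}
    (hV : P.IsClosed V) (hmV : m ∈ V) {v : P.carrier} (hvY : v ∈ Y) (hv : v ∈ V) : y ∈ V := by
  have := hG Y hY v hvY m hm hmY
  have hle := closureSet_subset (S := {v, m}) hV (by rintro _ (rfl | rfl) <;> assumption)
  rw [this] at hle
  exact hle (hY.subset hy)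

theorem AbsorbsUp.exists_majority_of_hits (hid : P.Idempotent)
    (hG : P.Spans (P.ClosureSet {y, m})) (hY : P.AbsorbsUp (P.ClosureSet {y, m}) Y)
    (hy : y ∈ Y) (hm : P.MaxIn (P.ClosureSet {y, m}) m) (hmY : m ∉ Y) (h : P.Hits Y y m 3) :
    ∃ g : Term σ 3, g.eval P ![m, y, y] = y ∧ g.eval P ![y, m, y] = y ∧
      g.eval P ![y, y, m] = y := by
  have hs := hid.isClosed_singleton y
  obtain ⟨g, hg⟩ := h
  have h₀ : g.eval P ![m, y, y] ∈ Y := by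
    convert hg 0 using 2
    funext i
    fin_cases i <;> rfl
  have h₁ : g.eval P ![y, m, y] ∈ Y := by
    convert hg 1 using 2
    funext i
    fin_cases i <;> rfl
  have h₂ : g.eval P ![y, y, m] ∈ Y := by
    convert hg 2 using 2
    funext i
    fin_cases i <;> rfl
  obtain ⟨g₁, hg₁, hq₁⟩ := hY.mem_of_meets hG hy hm hmY
    (V := P.valuesAt ![y, y, m] ![![m, y, y], ![y, m, y]] ![Y, Y])
    (isClosed_valuesAt _ _ (by simp [Fin.forall_fin_two, hY.closed]))
    ⟨.var 2, rfl, by simp [Fin.forall_fin_two, Term.eval, hy]⟩ h₂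
    ⟨g, rfl, by simp [Fin.forall_fin_two, h₀, h₁]⟩
  obtain ⟨g₂, hg₂, hq₂⟩ := hY.mem_of_meets hG hy hm hmY
    (V := P.valuesAt ![y, m, y] ![![m, y, y], ![y, y, m]] ![Y, {y}])
    (isClosed_valuesAt _ _ (by simp [Fin.forall_fin_two, hY.closed, hs]))
    ⟨.var 1, rfl, by simp [Fin.forall_fin_two, Term.eval, hy]⟩ (hq₁ 1)
    ⟨g₁, rfl, by simpa [Fin.forall_fin_two, hg₁] using hq₁ 0⟩
  obtain ⟨g₃, hg₃, hq₃⟩ := hY.mem_of_meets hG hy hm hmY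
    (V := P.valuesAt ![m, y, y] ![![y, m, y], ![y, y, m]] ![{y}, {y}])
    (isClosed_valuesAt _ _ (by simp [Fin.forall_fin_two, hs]))
    ⟨.var 0, rfl, by simp [Fin.forall_fin_two, Term.eval]⟩ (hq₂ 0)
    ⟨g₂, rfl, by simpa [Fin.forall_fin_two, hg₂] using hq₂ 1⟩
  exact ⟨g₃, hg₃, hq₃ 0, hq₃ 1⟩

end

end UAlgebra

namespace UAlgebra

variable {σ : Signature}

section

variable {P : UAlgebra σ} {Y : Set P.carrier} {y m : P.carrier}

theorem AbsorbsUp.not_isSemilatticeOn [Finite P.carrier] (hid : P.Idempotent)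
    (hG : P.Spans (P.ClosureSet {y, m})) (hY : P.AbsorbsUp (P.ClosureSet {y, m}) Y)
    (hy : y ∈ Y) (hm : P.MaxIn (P.ClosureSet {y, m}) m) (hmY : m ∉ Y)
    {θ : Congruence (P.Sg {y, m})} (hθ : ¬ θ.IsFull) (t : Term σ 2) :
    ¬ IsSemilatticeOn (fun u v => t.eval ((P.Sg {y, m}).quot θ) ![u, v])
      {P.qa y m θ, P.qb y m θ} := by
  rintro ⟨hsi, hsc, hsa⟩
  let S := P.Sg {y, m}
  have hSid : S.Idempotent := subalg_idempotent hid _ _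
  have : Finite S.carrier := inferInstanceAs (Finite {x : P.carrier // _})
  set a := P.qa y m θ with ha
  set b := P.qb y m θ with hb
  have haS : a ∈ ({a, b} : Set (S.quot θ).carrier) := by simp
  have hbS : b ∈ ({a, b} : Set (S.quot θ).carrier) := by simp
  dsimp only at hsi hsc hsa
  set d := t.eval (S.quot θ) ![a, b] with hd
  have hba : t.eval (S.quot θ) ![b, a] = d := (hsc a haS b hbS).symm
  have had : t.eval (S.quot θ) ![a, d] = d := by
    rw [hd, hsa a haS a haS b hbS, hsi a haS]
  have hda : t.eval (S.quot θ) ![d, a] = d := by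
    rw [← hba, ← hsa b hbS a haS a haS, hsi a haS]
  have hbd : t.eval (S.quot θ) ![b, d] = d := by
    rw [← hba, hsa b hbS b hbS a haS, hsi b hbS]
  have hdb : t.eval (S.quot θ) ![d, b] = d := by
    rw [hd, ← hsa a haS b hbS b hbS, hsi b hbS]
  set Z : Set S.carrier := {z | Quotient.mk θ.toSetoid z = d} with hZ
  have hZc : S.IsClosed Z := by
    intro f x hx
    change Quotient.mk θ.toSetoid _ = d
    rw [isHom_mk θ f x, funext hx]
    exact quot_idempotent hSid θ f d
  obtain ⟨e, he, heZ, -⟩ := exists_thinning hSid t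
  set c := t.eval S ![P.sgA y m, P.sgB y m] with hc
  have hcZ : c ∈ Z := (θ.eval_mk_pair t _ _).symm
  have hy'Z : e.eval S ![P.sgA y m, c] ∈ Z := by
    refine heZ _ Z (fun z hz => ⟨?_, ?_⟩) (fun z hz z' hz' => hZc.eval_pair_mem t hz hz') c hcZ
    · change Quotient.mk θ.toSetoid _ = d
      rw [← θ.eval_mk_pair, show Quotient.mk θ.toSetoid z = d from hz]
      exact had
    · change Quotient.mk θ.toSetoid _ = d
      rw [← θ.eval_mk_pair, show Quotient.mk θ.toSetoid z = d from hz]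
      exact hda
  have hm'Z : e.eval S ![P.sgB y m, c] ∈ Z := by
    refine heZ _ Z (fun z hz => ⟨?_, ?_⟩) (fun z hz z' hz' => hZc.eval_pair_mem t hz hz') c hcZ
    · change Quotient.mk θ.toSetoid _ = d
      rw [← θ.eval_mk_pair, show Quotient.mk θ.toSetoid z = d from hz]
      exact hbd
    · change Quotient.mk θ.toSetoid _ = d
      rw [← θ.eval_mk_pair, show Quotient.mk θ.toSetoid z = d from hz]
      exact hdb
  set y' := e.eval S ![P.sgA y m, c]
  set m' := e.eval S ![P.sgB y m, c]
  have hval : S.IsHom P Subtype.val := isHom_val _ _ _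
  have hyy' : P.IsThinSLEdge y y'.1 := (he (P.sgA y m) c).map hval
  have hmm' : P.IsThinSLEdge m m'.1 := (he (P.sgB y m) c).map hval
  have hmr : P.ReachIn (P.ClosureSet {y, m}) m m'.1 := .single ⟨hmm', m'.2⟩
  have hspan := hG Y hY y'.1 (hY.up y hy _ y'.2 hyy') m'.1 (hm.of_reachIn hmr)
    fun h => hmY (hY.reachIn h (hm.2 _ hmr))
  have hV : P.IsClosed (Subtype.val '' Z) := by
    intro f x hx
    choose z hz hzx using hx
    refine ⟨S.interp f z, hZc f z hz, ?_⟩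
    rw [hval f z]
    exact congrArg _ (funext hzx)
  have hle := closureSet_subset (S := {y'.1, m'.1}) hV (by
    rintro _ (rfl | rfl)
    exacts [⟨_, hy'Z, rfl⟩, ⟨_, hm'Z, rfl⟩])
  rw [hspan] at hle
  have hall : ∀ z : S.carrier, Quotient.mk θ.toSetoid z = d := fun z => by
    obtain ⟨z', hz', h⟩ := hle z.2
    rw [← Subtype.ext h]
    exact hz'
  exact hθ fun x z => θ.mk_eq_mk.1 ((hall x).trans (hall z).symm)

theorem AbsorbsUp.isMajEdge [Finite P.carrier] (hid : P.Idempotent)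
    (hG : P.Spans (P.ClosureSet {y, m})) (hY : P.AbsorbsUp (P.ClosureSet {y, m}) Y)
    (hy : y ∈ Y) (hm : P.MaxIn (P.ClosureSet {y, m}) m) (hmY : m ∉ Y)
    (hstab : P.linkSet y m (P.linkSet y m Y) = Y) {g : Term σ 3}
    (hg₀ : g.eval P ![m, y, y] = y) (hg₁ : g.eval P ![y, m, y] = y)
    (hg₂ : g.eval P ![y, y, m] = y) : P.IsMajEdge y m := by
  let S := P.Sg {y, m}
  have hSid : S.Idempotent := subalg_idempotent hid _ _
  have : Finite S.carrier := inferInstanceAs (Finite {x : P.carrier // _})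
  have hval : S.IsHom P Subtype.val := isHom_val _ _ _
  let T : S.carrier → S.carrier → Prop := fun x z => ∃ c, P.Link y m x.1 c ∧ P.Link y m z.1 c
  let lam : Congruence S := Congruence.ofTolerance T
    (fun x => (exists_link x.2).imp fun c h => ⟨h, h⟩)
    (fun x z h => h.imp fun c h => h.symm)
    (fun f x z h => by
      choose c hx hz using h
      exact ⟨_, Link.app f hx, Link.app f hz⟩)
  have hsat : ∀ x z, lam.rel x z → x.1 ∈ Y → z.1 ∈ Y := fun x z h hx => by
    induction h with
    | refl => exact hx
    | tail _ h ih =>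
      obtain ⟨c, h₁, h₂⟩ := h
      rw [← hstab]
      exact mem_linkSet.2 ⟨c, mem_linkSet.2 ⟨_, ih, h₁⟩, h₂.symm⟩
  obtain ⟨θ, hle, hmax⟩ := lam.exists_isMaximal fun h =>
    hmY (hsat (P.sgA y m) (P.sgB y m) (h _ _) hy)
  have hmy : ∀ u : Term σ 3, ∀ x : Fin 3 → S.carrier, ∀ s : Term σ 2,
      (s.eval P ![y, m] = y) → (u.eval S x).1 = s.eval P ![m, y] →
      θ.rel (u.eval S x) (P.sgB y m) := fun u x s h h' => by
    refine hle _ _ (.single ⟨y, Link.symm ⟨s, h, h'.symm⟩, ?_⟩)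
    exact (link_self y m).symm
  have hcomp : ∀ (i j k : Fin 2) (x : Fin 2 → P.carrier),
      (g.subst ![.var i, .var j, .var k]).eval P x = g.eval P ![x i, x j, x k] := by
    intro i j k x
    rw [Term.eval_subst]
    congr 1
    funext l
    fin_cases l <;> rfl
  refine ⟨fun h => hmY (h ▸ hy), θ, hmax, ⟨g, ?_⟩,
    fun ⟨t, ht⟩ => hY.not_isSemilatticeOn hid hG hy hm hmY hmax.1 t ht⟩
  apply isMajorityOn_pair <;> simp only [qa, qb, Congruence.eval_mk_triple]
  · rw [hSid.eval_triple]
  · rw [hSid.eval_triple]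
  · rw [show g.eval S ![P.sgA y m, P.sgA y m, P.sgB y m] = P.sgA y m from
      Subtype.ext ((hval.map_eval_triple _ _ _ _).trans hg₂)]
  · rw [show g.eval S ![P.sgA y m, P.sgB y m, P.sgA y m] = P.sgA y m from
      Subtype.ext ((hval.map_eval_triple _ _ _ _).trans hg₁)]
  · rw [show g.eval S ![P.sgB y m, P.sgA y m, P.sgA y m] = P.sgA y m from
      Subtype.ext ((hval.map_eval_triple _ _ _ _).trans hg₀)]
  · exact θ.mk_eq_mk.2 (hmy g _ _ ((hcomp 0 0 1 _).trans hg₂)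
      ((hval.map_eval_triple _ _ _ _).trans (hcomp 0 0 1 ![m, y]).symm))
  · exact θ.mk_eq_mk.2 (hmy g _ _ ((hcomp 0 1 0 _).trans hg₁)
      ((hval.map_eval_triple _ _ _ _).trans (hcomp 0 1 0 ![m, y]).symm))
  · exact θ.mk_eq_mk.2 (hmy g _ _ ((hcomp 1 0 0 _).trans hg₀)
      ((hval.map_eval_triple _ _ _ _).trans (hcomp 1 0 0 ![m, y]).symm))

end

theorem AbsorbsUp.mem_of_spans {P : UAlgebra σ} [Finite P.carrier] (hid : P.Idempotent)
    (hmf : P.MajorityFree) {B Y₀ : Set P.carrier} (hG : P.Spans B) (hY₀ : P.AbsorbsUp B Y₀)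
    {m : P.carrier} (hm : P.MaxIn B m) : m ∈ Y₀ := by
  by_contra hmY₀
  obtain ⟨y₀, hy₀⟩ := hY₀.nonempty
  obtain ⟨y, hy₀y, hymax⟩ := exists_maxIn (hY₀.subset hy₀)
  have hyY₀ := hY₀.reachIn hy₀ hy₀y
  obtain rfl := hG Y₀ hY₀ y hyY₀ m hm hmY₀
  obtain ⟨Y, ⟨hY, hy, hmY⟩, hmaxY⟩ := Set.exists_max_image
    {Y | P.AbsorbsUp (P.ClosureSet {y, m}) Y ∧ y ∈ Y ∧ m ∉ Y} Set.ncard (Set.toFinite _)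
    ⟨Y₀, hY₀, hyY₀, hmY₀⟩
  have hE := hY.linkSet hid
  have hmE : m ∈ P.linkSet y m Y := mem_linkSet.2 ⟨y, hy, link_self y m⟩
  have hyE : y ∉ P.linkSet y m Y := fun h => by
    obtain ⟨b, hb, hl⟩ := mem_linkSet.1 h
    exact hY.not_link hid hG hy hm hmY hb hy hl
  have hEE : ∀ b ∈ P.linkSet y m Y, ∀ c ∈ P.linkSet y m Y, ¬ P.Link y m b c :=
    fun b hb c hc h => hE.not_link hid hG hmE hymax hyE hc hb h.swap
  have hstab : P.linkSet y m (P.linkSet y m Y) = Y := by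
    refine (Set.eq_of_subset_of_ncard_le (fun b hb => ?_) (hmaxY _ ⟨hE.linkSet hid, ?_, ?_⟩)
      (Set.toFinite _)).symm
    · obtain ⟨c, hc⟩ := exists_link (hY.subset hb)
      exact mem_linkSet.2 ⟨c, mem_linkSet.2 ⟨b, hb, hc⟩, hc.symm⟩
    · exact mem_linkSet.2 ⟨m, hmE, (link_self y m).symm⟩
    · intro h
      obtain ⟨c, hc, hl⟩ := mem_linkSet.1 h
      exact hEE c hc m hmE hl
  have hhit : ∃ n, P.Hits Y y m n := by
    obtain ⟨n, s, hs⟩ := hY.absorbs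
    refine ⟨n, s, fun i => hs _ (fun j => mem_closureSet_of_eq_or (update_eq_or y m i j)) i
      fun j hj => ?_⟩
    rw [Function.update_of_ne hj]
    exact hy
  have hthree : P.Hits Y y m 3 := by
    classical
    have hmin := fun k (hk : k < Nat.find hhit) => Nat.find_min hhit hk
    have hspec := Nat.find_spec hhit
    generalize Nat.find hhit = n at hmin hspec
    match n, hmin, hspec with
    | 0, _, ⟨t, _⟩ =>
      refine absurd hy ?_
      rw [← hid.eval_const t y, show (fun _ : Fin 0 => y) = fun _ => m from funext nofun,
        hid.eval_const t m]
      exact hmY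
    | 1, _, ⟨t, ht⟩ =>
      refine absurd (ht 0) ?_
      rw [show Function.update (fun _ => y) (0 : Fin 1) m = fun _ => m from
        funext fun i => by rw [Subsingleton.elim i 0, Function.update_self], hid.eval_const t m]
      exact hmY
    | 2, _, h => exact absurd h (hY.not_hits_two hid hG hy hm hmY)
    | 3, _, h => exact h
    | k + 4, hmin, h =>
      exact hY.hits_three_of_hits hid hG hy hstab h (hmin _ (Nat.lt_succ_self _))
  obtain ⟨g, hg₀, hg₁, hg₂⟩ := hY.exists_majority_of_hits hid hG hy hm hmY hthree
  exact hmf y m (hY.isMajEdge hid hG hy hm hmY hstab hg₀ hg₁ hg₂)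

theorem AbsorbsUp.inter {P : UAlgebra σ} {B B' Y : Set P.carrier} (hY : P.AbsorbsUp B Y)
    (hB' : P.IsClosed B') (h : B' ⊆ B) (hne : (Y ∩ B').Nonempty) :
    P.AbsorbsUp B' (Y ∩ B') where
  subset := Set.inter_subset_right
  nonempty := hne
  closed := isClosed_inter hY.closed hB'
  absorbs := by
    obtain ⟨n, s, hs⟩ := hY.absorbs
    exact ⟨n, s, fun x hx i hi => ⟨hs x (fun j => h (hx j)) i fun j hj => (hi j hj).1,
      hB'.eval_mem s hx⟩⟩
  up x hx y hy hxy := ⟨hY.up x hx.1 y (h hy) hxy, hy⟩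

/-- In a majority free algebra, an absorbing up-closed subuniverse contains all maximal
elements. -/
theorem AbsorbsUp.mem_of_maxIn {P : UAlgebra σ} [Finite P.carrier] (hid : P.Idempotent)
    (hmf : P.MajorityFree) {B Y : Set P.carrier} (hB : P.IsClosed B) (hY : P.AbsorbsUp B Y)
    {m : P.carrier} (hm : P.MaxIn B m) : m ∈ Y := by
  induction hcard : B.ncard using Nat.strong_induction_on generalizing B Y m with
  | _ N ih =>
  subst hcard
  refine hY.mem_of_spans hid hmf ?_ hm
  intro Y hY y hy m hm hmY
  by_contra hne
  have hsub : P.ClosureSet {y, m} ⊆ B := closureSet_subset hB (by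
    rintro _ (rfl | rfl)
    exacts [hY.subset hy, hm.1])
  have hy' : y ∈ P.ClosureSet {y, m} := subset_closureSet _ _ (by simp)
  have hm' : m ∈ P.ClosureSet {y, m} := subset_closureSet _ _ (by simp)
  obtain ⟨c, hmc, hc⟩ := exists_maxIn hm'
  have hcY := ih _ (Set.ncard_lt_ncard (hsub.ssubset_of_ne hne) (Set.toFinite _))
    (P.closureSet_isClosed _) (hY.inter (P.closureSet_isClosed _) hsub ⟨y, hy, hy'⟩) hc rfl
  exact hmY (hY.reachIn hcY.1 (hm.2 c (hmc.mono hsub)))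

end UAlgebra

namespace UAlgebra

variable {σ : Signature}

/-- On tuples from `R`, the truth value of `χ` at the value of a term is given by one of the
coordinates. -/
def ProjectsTo (P : UAlgebra σ) (R : Set P.carrier) (χ : P.carrier → Prop) : Prop :=
  ∀ (n : ℕ) (t : Term σ n), ∃ i, ∀ v : Fin n → P.carrier, (∀ j, v j ∈ R) →
    (χ (t.eval P v) ↔ χ (v i))

theorem OmitsType1.not_projectsTo {A : UAlgebra σ} (h1 : A.OmitsType1) {S : Set A.carrier}
    (hS : A.IsClosed S) {χ : A.carrier → Prop} {a b : A.carrier} (ha : a ∈ S) (hb : b ∈ S)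
    (hχa : χ a) (hχb : ¬ χ b) : ¬ A.ProjectsTo S χ := by
  intro hproj
  refine h1 S hS ⟨a, ha⟩ ⟨b, hb⟩ ⟨fun h => hχb ?_, ?_⟩
  · obtain rfl : a = b := congrArg Subtype.val h
    exact hχa
  set Q := (A.subalg S hS).Sg {⟨a, ha⟩, ⟨b, hb⟩} with hQ
  let val : Q.carrier → A.carrier := fun x => x.1.1
  have hval : Q.IsHom A val := fun _ _ => rfl
  have hvS : ∀ x, val x ∈ S := fun x => x.1.2
  let θ : Congruence Q :=
    { rel := fun x z => (χ (val x) ↔ χ (val z))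
      refl := fun _ => Iff.rfl
      symm := Iff.symm
      trans := Iff.trans
      compat := fun f x z h => by
        obtain ⟨i, hi⟩ := hproj _ (.app f .var)
        rw [hval, hval]
        exact (hi (fun j => val (x j)) fun j => hvS _).trans
          ((h i).trans (hi (fun j => val (z j)) fun j => hvS _).symm) }
  refine ⟨θ, ⟨fun h => ?_, fun η hη hfull x z hxz => ?_⟩, fun n t => ?_⟩
  · have : χ a ↔ χ b := h (sgA _ _ _) (sgB _ _ _)
    exact hχb (this.1 hχa)
  · by_contra hne
    have hcover : ∀ u, η.rel u x := fun u => by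
      by_cases hu : χ (val u) ↔ χ (val x)
      · exact hη _ _ hu
      · refine η.trans (hη u z ?_) (η.symm hxz)
        change χ (val u) ↔ χ (val z)
        have hne' : ¬ (χ (val x) ↔ χ (val z)) := hne
        tauto
    exact hfull fun u v => η.trans (hcover u) (η.symm (hcover v))
  · obtain ⟨i, hi⟩ := hproj n t
    refine ⟨i, fun x => ?_⟩
    obtain ⟨r, rfl⟩ : ∃ r : Fin n → Q.carrier, (fun j => Quotient.mk θ.toSetoid (r j)) = x :=
      ⟨fun j => (x j).out, funext fun j => Quotient.out_eq (x j)⟩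
    rw [θ.eval_mk]
    refine θ.mk_eq_mk.2 ?_
    change χ (val _) ↔ χ (val _)
    rw [hval.map_eval]
    exact hi _ fun j => hvS _

/-- A projecting predicate on a subalgebra of a power of `A` yields one on a subalgebra
of `A`. -/
theorem ProjectsTo.exists_of_hom {A Q : UAlgebra σ} (hid : A.Idempotent) {K : Type} [Finite K]
    {h : K → Q.carrier → A.carrier} (hh : ∀ k, Q.IsHom A (h k)) {χ : Q.carrier → Prop}
    (hχ : ∀ r r', (∀ k, h k r = h k r') → (χ r ↔ χ r')) {R : Set Q.carrier}
    (hR : Q.IsClosed R) (hproj : Q.ProjectsTo R χ) {r r' : Q.carrier} (hr : r ∈ R)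
    (hr' : r' ∈ R) (hχr : χ r) (hχr' : ¬ χ r') :
    ∃ (S : Set A.carrier) (χ' : A.carrier → Prop), A.IsClosed S ∧ A.ProjectsTo S χ' ∧
      ∃ a ∈ S, ∃ b ∈ S, χ' a ∧ ¬ χ' b := by
  induction hcard : {k | ∃ s ∈ R, ∃ s' ∈ R, h k s ≠ h k s'}.ncard using
    Nat.strong_induction_on generalizing R r r' with
  | _ N ih =>
  subst hcard
  obtain ⟨k, hk⟩ : ∃ k, h k r ≠ h k r' := by
    by_contra! hk
    exact hχr' ((hχ r r' hk).1 hχr)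
  by_cases hfac : ∀ s ∈ R, ∀ s' ∈ R, h k s = h k s' → χ s → χ s'
  · have hiff : ∀ s ∈ R, ((∃ s' ∈ R, h k s' = h k s ∧ χ s') ↔ χ s) := fun s hs =>
      ⟨fun ⟨s', hs', he, hc⟩ => hfac s' hs' s hs he hc, fun hc => ⟨s, hs, rfl, hc⟩⟩
    refine ⟨h k '' R, fun a => ∃ s ∈ R, h k s = a ∧ χ s, fun f x hx => ?_, fun n t => ?_,
      _, ⟨r, hr, rfl⟩, _, ⟨r', hr', rfl⟩, (hiff r hr).2 hχr, fun hc => hχr' ((hiff r' hr').1 hc)⟩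
    · choose s hs hsx using hx
      exact ⟨Q.interp f s, hR f s hs, by rw [hh k f s, funext hsx]⟩
    · obtain ⟨i, hi⟩ := hproj n t
      refine ⟨i, fun v hv => ?_⟩
      choose s hs hsv using hv
      obtain rfl : (fun j => h k (s j)) = v := funext hsv
      rw [← (hh k).map_eval]
      exact (hiff _ (hR.eval_mem t hs)).trans ((hi s hs).trans (hiff _ (hs i)).symm)
  · push Not at hfac
    obtain ⟨s, hs, s', hs', he, hc, hc'⟩ := hfac
    refine ih _ (Set.ncard_lt_ncard (t := {k | ∃ s ∈ R, ∃ s' ∈ R, h k s ≠ h k s'}) ?_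
      (Set.toFinite _)) (R := R ∩ {u | h k u = h k s}) (fun f x hx => ⟨hR f x fun j => (hx j).1,
        ?_⟩) (fun n t => (hproj n t).imp fun i hi v hv => hi v fun j => (hv j).1)
      ⟨hs, rfl⟩ ⟨hs', he.symm⟩ hc hc' rfl
    · refine ⟨?_, fun hsub => ?_⟩
      · rintro l ⟨u, hu, u', hu', hne⟩
        exact ⟨u, hu.1, u', hu'.1, hne⟩
      · obtain ⟨u, hu, u', hu', hne⟩ := hsub ⟨r, hr, r', hr', hk⟩
        exact hne (hu.2.trans hu'.2.symm)
    · change h k _ = h k s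
      rw [hh k f x, show (fun j => h k (x j)) = fun _ => h k s from funext fun j => (hx j).2]
      exact hid f _

/-- The algebra of binary terms. -/
def termAlgebra (σ : Signature) (n : ℕ) : UAlgebra σ where
  carrier := Term σ n
  interp f ts := .app f ts

theorem eval_eval_termAlgebra {P : UAlgebra σ} {n m : ℕ} (t : Term σ n) (v : Fin n → Term σ m)
    (x : Fin m → P.carrier) :
    Term.eval P (t.eval (termAlgebra σ m) v : Term σ m) x =
      t.eval P fun i => (v i).eval P x :=
  IsHom.map_eval (A := termAlgebra σ m) (φ := fun u => Term.eval P u x) (fun _ _ => rfl) t v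

/-- No coordinate of `t` absorbs `W` into `Z`. -/
def Moves (P : UAlgebra σ) (W Z : Set P.carrier) {n : ℕ} (t : Term σ n) : Prop :=
  ∀ i, ∃ v : Fin n → P.carrier, (∀ j, v j ∈ W) ∧ v i ∈ Z ∧ t.eval P v ∉ Z

/-- `W` has no proper nonempty subuniverse which is absorbing by a binary term. -/
def BinaryAbsorptionFree (P : UAlgebra σ) (W : Set P.carrier) : Prop :=
  ∀ Z ⊆ W, Z.Nonempty → P.IsClosed Z → ∀ u : Term σ 2,
    (∀ x ∈ Z, ∀ y ∈ W, u.eval P ![x, y] ∈ Z ∧ u.eval P ![y, x] ∈ Z) → Z = W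

theorem BinaryAbsorptionFree.exists_moves {A P : UAlgebra σ} [Finite P.carrier]
    (hid : A.Idempotent) (h1 : A.OmitsType1) {K : Type} [Finite K]
    {h : K → P.carrier → A.carrier} (hh : ∀ k, P.IsHom A (h k))
    (hinj : ∀ x y, (∀ k, h k x = h k y) → x = y) {W : Set P.carrier}
    (hWc : P.IsClosed W) (hW : P.BinaryAbsorptionFree W) {Z : Set P.carrier} (hZW : Z ⊆ W) (hZ : Z.Nonempty)
    (hne : Z ≠ W) : ∃ (n : ℕ) (t : Term σ n), P.Moves W Z t := by
  classical
  by_contra! hcon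
  have hcoord : ∀ (n : ℕ) (t : Term σ n), ∃ i, ∀ v : Fin n → P.carrier, (∀ j, v j ∈ W) →
      v i ∈ Z → t.eval P v ∈ Z := fun n t => by
    have := hcon n t
    unfold Moves at this
    push Not at this
    exact this
  have hZc : P.IsClosed Z := fun f x hx => by
    obtain ⟨i, hi⟩ := hcoord _ (.app f .var)
    exact hi x (fun j => hZW (hx j)) (hx i)
  have huniq : ∀ u : Term σ 2, (∀ x ∈ Z, ∀ y ∈ W, u.eval P ![x, y] ∈ Z) →
      ¬ ∀ x ∈ Z, ∀ y ∈ W, u.eval P ![y, x] ∈ Z := fun u h₀ h₁ =>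
    hne (hW Z hZW hZ hZc u fun x hx y hy => ⟨h₀ x hx y hy, h₁ x hx y hy⟩)
  have hpair : ∀ {x y : P.carrier}, x ∈ W → y ∈ W → ∀ j : Fin 2, ![x, y] j ∈ W :=
    fun hx hy => Fin.forall_fin_two.2 ⟨hx, hy⟩
  have hor : ∀ u : Term σ 2, (∀ x ∈ Z, ∀ y ∈ W, u.eval P ![x, y] ∈ Z) ∨
      ∀ x ∈ Z, ∀ y ∈ W, u.eval P ![y, x] ∈ Z := fun u => by
    obtain ⟨i, hi⟩ := hcoord 2 u
    fin_cases i
    · exact .inl fun x hx y hy => hi _ (hpair (hZW hx) hy) hx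
    · exact .inr fun x hx y hy => hi _ (hpair hy (hZW hx)) hx
  let χ : Term σ 2 → Prop := fun u => ∀ x ∈ Z, ∀ y ∈ W, u.eval P ![x, y] ∈ Z
  have hproj : (termAlgebra σ 2).ProjectsTo Set.univ χ := fun n t => by
    obtain ⟨i, hi⟩ := hcoord n t
    refine ⟨i, fun v _ => ⟨fun hc => ?_, fun hc x hx y hy => ?_⟩⟩
    · by_contra hvi
      refine huniq _ hc fun x hx y hy => ?_
      refine (congrArg (· ∈ Z) (eval_eval_termAlgebra t v _)).mpr ?_
      exact hi _ (fun j => hWc.eval_pair_mem (v j) hy (hZW hx))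
        ((hor (v i)).resolve_left hvi x hx y hy)
    · refine (congrArg (· ∈ Z) (eval_eval_termAlgebra t v _)).mpr ?_
      exact hi _ (fun j => hWc.eval_pair_mem (v j) (hZW hx) hy) (hc x hx y hy)
  obtain ⟨y, hyW, hyZ⟩ := Set.exists_of_ssubset (hZW.ssubset_of_ne hne)
  obtain ⟨x, hx⟩ := hZ
  obtain ⟨S, χ', hS, hSχ, a, ha, b, hb, hχa, hχb⟩ := ProjectsTo.exists_of_hom (A := A) hid
    (K := P.carrier × P.carrier × K) (h := fun k (u : Term σ 2) => h k.2.2 (u.eval P ![k.1, k.2.1]))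
    (fun k f ts => hh k.2.2 f _)
    (fun (r r' : Term σ 2) he => by
      have : ∀ x y, r.eval P ![x, y] = r'.eval P ![x, y] := fun x y =>
        hinj _ _ fun k => he (x, y, k)
      simp only [χ, this])
    (R := Set.univ) (fun _ _ _ => trivial) hproj (r := Term.var 0) (r' := Term.var 1)
    trivial trivial
    (fun x hx y _ => hx) (fun hc => hyZ (hc x hx y hyW))
  exact h1.not_projectsTo hS ha hb hχa hχb hSχ

end UAlgebra

namespace UAlgebra

variable {σ : Signature} {P : UAlgebra σ} {W : Set P.carrier}

theorem Moves.star_left (hid : P.Idempotent) {Z : Set P.carrier} {n m : ℕ} {t : Term σ n}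
    (ht : P.Moves W Z t) (s : Term σ m) : P.Moves W Z (t.star s) := by
  intro c
  obtain ⟨v, hvW, hvZ, hv⟩ := ht (finProdFinEquiv.symm c).1
  refine ⟨fun c' => v (finProdFinEquiv.symm c').1, fun c' => hvW _, hvZ, ?_⟩
  rw [Term.eval_star]
  simp only [Equiv.symm_apply_apply, hid.eval_const]
  exact hv

theorem Moves.star_right (hid : P.Idempotent) {Z : Set P.carrier} {n m : ℕ} {t : Term σ n}
    (ht : P.Moves W Z t) (s : Term σ m) : P.Moves W Z (s.star t) := by
  intro c
  obtain ⟨v, hvW, hvZ, hv⟩ := ht (finProdFinEquiv.symm c).2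
  refine ⟨fun c' => v (finProdFinEquiv.symm c').2, fun c' => hvW _, hvZ, ?_⟩
  rw [Term.eval_star]
  simp only [Equiv.symm_apply_apply, hid.eval_const]
  exact hv

/-- A single term witnesses that no proper nonempty subset of `W` is absorbing in any
coordinate. -/
theorem exists_moves_all [Finite P.carrier] (hid : P.Idempotent)
    (h : ∀ Z ⊆ W, Z.Nonempty → Z ≠ W → ∃ (n : ℕ) (t : Term σ n), P.Moves W Z t) :
    ∃ (n : ℕ) (t : Term σ n), ∀ Z ⊆ W, Z.Nonempty → Z ≠ W → P.Moves W Z t := by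
  classical
  have key : ∀ F : Finset (Set P.carrier), (∀ Z ∈ F, ∃ (n : ℕ) (t : Term σ n), P.Moves W Z t) →
      ∃ (n : ℕ) (t : Term σ n), ∀ Z ∈ F, P.Moves W Z t := fun F => by
    induction F using Finset.induction with
    | empty => exact fun _ => ⟨1, .var 0, by simp⟩
    | insert Z F _ ih =>
      intro hF
      obtain ⟨n, t, ht⟩ := ih fun Z hZ => hF Z (Finset.mem_insert_of_mem hZ)
      obtain ⟨m, s, hs⟩ := hF Z (Finset.mem_insert_self Z F)
      refine ⟨_, t.star s, fun Z' hZ' => ?_⟩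
      obtain rfl | hZ' := Finset.mem_insert.1 hZ'
      exacts [hs.star_right hid t, (ht Z' hZ').star_left hid s]
  have hfin : {Z | Z ⊆ W ∧ Z.Nonempty ∧ Z ≠ W}.Finite := Set.toFinite _
  obtain ⟨n, t, ht⟩ := key hfin.toFinset fun Z hZ => by
    obtain ⟨h₁, h₂, h₃⟩ := hfin.mem_toFinset.1 hZ
    exact h Z h₁ h₂ h₃
  exact ⟨n, t, fun Z h₁ h₂ h₃ => ht Z (hfin.mem_toFinset.2 ⟨h₁, h₂, h₃⟩)⟩

/-- The values of `t` on tuples from `W` whose `i`-th entry is `q`. -/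
def valuesThrough (P : UAlgebra σ) (W : Set P.carrier) (q : P.carrier) {n : ℕ} (t : Term σ n)
    (i : Fin n) : Set P.carrier :=
  {w | ∃ v : Fin n → P.carrier, (∀ j, v j ∈ W) ∧ v i = q ∧ t.eval P v = w}

theorem mem_valuesThrough_star (hid : P.Idempotent) {q : P.carrier} {n m : ℕ} (t : Term σ n)
    (s : Term σ m) (c : Fin (n * m)) {u : Fin n → P.carrier} (hu : ∀ j, u j ∈ W)
    (hc : u (finProdFinEquiv.symm c).1 ∈ P.valuesThrough W q s (finProdFinEquiv.symm c).2) :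
    t.eval P u ∈ P.valuesThrough W q (t.star s) c := by
  classical
  obtain ⟨v, hvW, hvq, hv⟩ := hc
  refine ⟨fun c' => if (finProdFinEquiv.symm c').1 = (finProdFinEquiv.symm c).1 then
    v (finProdFinEquiv.symm c').2 else u (finProdFinEquiv.symm c').1, fun c' => ?_, ?_, ?_⟩
  · dsimp only
    split_ifs
    exacts [hvW _, hu _]
  · dsimp only
    rw [if_pos rfl, hvq]
  · rw [Term.eval_star]
    congr 1
    funext j
    simp only [Equiv.symm_apply_apply]
    by_cases hj : j = (finProdFinEquiv.symm c).1
    · simp only [if_pos hj]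
      rw [hv, hj]
    · simp only [if_neg hj]
      exact hid.eval_const s _

/-- If no proper nonempty subset of `W` is absorbing in any coordinate of suitable terms, then
some term moves `q` to `p` from every coordinate. -/
theorem exists_transitive_term [Finite P.carrier] (hid : P.Idempotent) (hWc : P.IsClosed W)
    (h : ∀ Z ⊆ W, Z.Nonempty → Z ≠ W → ∃ (n : ℕ) (t : Term σ n), P.Moves W Z t)
    {p q : P.carrier} (hp : p ∈ W) (hq : q ∈ W) :
    ∃ (n : ℕ) (t : Term σ n), ∀ i, p ∈ P.valuesThrough W q t i := by
  obtain ⟨N, T, hT⟩ := exists_moves_all hid h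
  have hsub : ∀ {n : ℕ} (t : Term σ n) i, P.valuesThrough W q t i ⊆ W := by
    rintro n t i _ ⟨v, hv, -, rfl⟩
    exact hWc.eval_mem t hv
  have key : ∀ k : ℕ, ∃ (n : ℕ) (t : Term σ n), ∀ i,
      W ⊆ P.valuesThrough W q t i ∨ k ≤ (P.valuesThrough W q t i).ncard := fun k => by
    induction k with
    | zero => exact ⟨1, .var 0, fun i => .inr (Nat.zero_le _)⟩
    | succ k ih =>
      obtain ⟨n, t, ht⟩ := ih
      refine ⟨_, T.star t, fun c => ?_⟩
      set Z := P.valuesThrough W q t (finProdFinEquiv.symm c).2 with hZ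
      have hle : Z ⊆ P.valuesThrough W q (T.star t) c := fun z hz => by
        have := mem_valuesThrough_star hid T t c (u := fun _ => z) (fun _ => hsub _ _ hz) hz
        rwa [hid.eval_const] at this
      by_cases hZW : Z = W
      · left
        exact hZW.ge.trans hle
      right
      have hZne : Z.Nonempty := ⟨q, fun _ => q, fun _ => hq, rfl, hid.eval_const t q⟩
      obtain ⟨v, hvW, hvZ, hv⟩ := hT Z (hsub _ _) hZne hZW (finProdFinEquiv.symm c).1
      have hcard := (ht (finProdFinEquiv.symm c).2).resolve_left fun hWZ =>
        hZW ((hsub _ _).antisymm hWZ)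
      refine Nat.succ_le_of_lt (hcard.trans_lt (Set.ncard_lt_ncard ?_ (Set.toFinite _)))
      exact ⟨hle, fun hge => hv (hge (mem_valuesThrough_star hid T t c hvW hvZ))⟩
  obtain ⟨n, t, ht⟩ := key (W.ncard + 1)
  refine ⟨n, t, fun i => ((ht i).resolve_right fun hle => ?_) hp⟩
  have := Set.ncard_le_ncard (hsub t i) (Set.toFinite _)
  omega

end UAlgebra

namespace UAlgebra

variable {σ : Signature}

theorem IsHom.isClosed_image {P Q : UAlgebra σ} {φ : P.carrier → Q.carrier} (hφ : P.IsHom Q φ)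
    {B : Set P.carrier} (hB : P.IsClosed B) : Q.IsClosed (φ '' B) := by
  intro f x hx
  choose y hyB hy using hx
  exact ⟨P.interp f y, hB f y hyB, by simp only [hφ f y, hy]⟩

theorem IsHom.isClosed_preimage {P Q : UAlgebra σ} {φ : P.carrier → Q.carrier}
    (hφ : P.IsHom Q φ) {B : Set Q.carrier} (hB : Q.IsClosed B) : P.IsClosed (φ ⁻¹' B) := by
  intro f x hx
  rw [Set.mem_preimage, hφ]
  exact hB f _ hx

theorem ReachIn.map {P Q : UAlgebra σ} {φ : P.carrier → Q.carrier} (hφ : P.IsHom Q φ)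
    {B : Set P.carrier} {B' : Set Q.carrier} (hB : Set.MapsTo φ B B') {x y : P.carrier}
    (h : P.ReachIn B x y) : Q.ReachIn B' (φ x) (φ y) :=
  Relation.ReflTransGen.lift φ (fun _ _ h => ⟨h.1.map hφ, hB h.2⟩) _ _ h

theorem AbsorbsUp.preimage {P Q : UAlgebra σ} {φ : P.carrier → Q.carrier} (hφ : P.IsHom Q φ)
    {B Y : Set Q.carrier} (hY : Q.AbsorbsUp B Y) (hne : (φ ⁻¹' Y).Nonempty) :
    P.AbsorbsUp (φ ⁻¹' B) (φ ⁻¹' Y) where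
  subset := Set.preimage_mono hY.subset
  nonempty := hne
  closed := hφ.isClosed_preimage hY.closed
  absorbs := by
    obtain ⟨n, s, hs⟩ := hY.absorbs
    refine ⟨n, s, fun x hx i hi => ?_⟩
    rw [Set.mem_preimage, hφ.map_eval]
    exact hs _ hx i hi
  up x hx y hy h := hY.up _ hx _ hy (h.map hφ)

section Prod

variable {A : UAlgebra σ}

instance [Finite A.carrier] : Finite (A.prod A).carrier :=
  inferInstanceAs (Finite (A.carrier × A.carrier))

/-- A thin semilattice edge of `A` is witnessed by a term defining thin semilattice edges of
`A × A`. -/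
theorem IsThinSLEdge.exists_term_prod [Finite A.carrier] (hid : A.Idempotent)
    {x y : A.carrier} (h : A.IsThinSLEdge x y) : ∃ e : Term σ 2,
      (∀ u v, (A.prod A).IsThinSLEdge u (e.eval (A.prod A) ![u, v])) ∧
      e.eval A ![x, y] = y := by
  have hd : (A.prod A).IsThinSLEdge (x, x) (y, y) :=
    h.map (φ := fun z => (z, z)) (Q := A.prod A) fun _ _ => rfl
  obtain ⟨e, he, hxy, -⟩ := hd.exists_term (prod_idempotent hid hid)
  refine ⟨e, he, ?_⟩
  exact ((isHom_fst A A).map_eval_pair e _ _).symm.trans (congrArg Prod.fst hxy)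

/-- Thin semilattice edges of the first projection of a subuniverse lift. -/
theorem exists_thin_lift [Finite A.carrier] (hid : A.Idempotent) {W : Set (A.prod A).carrier}
    (hW : (A.prod A).IsClosed W) {u : (A.prod A).carrier} (hu : u ∈ W) {y : A.carrier}
    (hy : y ∈ Prod.fst '' W) (h : A.IsThinSLEdge u.1 y) :
    ∃ v ∈ W, (A.prod A).IsThinSLEdge u v ∧ v.1 = y := by
  obtain ⟨w, hw, rfl⟩ := hy
  obtain ⟨e, he, hxy⟩ := h.exists_term_prod hid
  exact ⟨_, hW.eval_pair_mem e hu hw, he u w, ((isHom_fst A A).map_eval_pair e u w).trans hxy⟩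

theorem exists_reachIn_lift [Finite A.carrier] (hid : A.Idempotent)
    {W : Set (A.prod A).carrier} (hW : (A.prod A).IsClosed W) {u : (A.prod A).carrier}
    (hu : u ∈ W) {y : A.carrier} (h : A.ReachIn (Prod.fst '' W) u.1 y) :
    ∃ v, (A.prod A).ReachIn W u v ∧ v.1 = y := by
  induction h with
  | refl => exact ⟨u, Relation.ReflTransGen.refl, rfl⟩
  | tail _ h ih =>
    obtain ⟨v, huv, rfl⟩ := ih
    obtain ⟨w, hw, hvw, rfl⟩ := exists_thin_lift hid hW (huv.mem hu) h.2 h.1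
    exact ⟨w, huv.tail ⟨hvw, hw⟩, rfl⟩

theorem MaxIn.image_fst [Finite A.carrier] (hid : A.Idempotent) {W : Set (A.prod A).carrier}
    (hW : (A.prod A).IsClosed W) {p : (A.prod A).carrier} (hp : (A.prod A).MaxIn W p) :
    A.MaxIn (Prod.fst '' W) p.1 := by
  refine ⟨⟨p, hp.1, rfl⟩, fun c hc => ?_⟩
  obtain ⟨v, hv, rfl⟩ := exists_reachIn_lift hid hW hp.1 hc
  exact (hp.2 v hv).map (isHom_fst A A) (Set.mapsTo_image _ _)

theorem AbsorbsUp.image_fst [Finite A.carrier] (hid : A.Idempotent)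
    {W X : Set (A.prod A).carrier} (hW : (A.prod A).IsClosed W)
    (hX : (A.prod A).AbsorbsUp W X) : A.AbsorbsUp (Prod.fst '' W) (Prod.fst '' X) where
  subset := Set.image_mono hX.subset
  nonempty := hX.nonempty.image _
  closed := (isHom_fst A A).isClosed_image hX.closed
  absorbs := by
    obtain ⟨n, s, hs⟩ := hX.absorbs
    refine ⟨n, s, fun x hx i hi => ?_⟩
    have hy : ∀ j, ∃ y : (A.prod A).carrier, y ∈ W ∧ y.1 = x j ∧ (j ≠ i → y ∈ X) := fun j => by
      by_cases hj : j = i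
      · obtain ⟨y, hy, hyx⟩ := hx j
        exact ⟨y, hy, hyx, fun h => absurd hj h⟩
      · obtain ⟨y, hy, hyx⟩ := hi j hj
        exact ⟨y, hX.subset hy, hyx, fun _ => hy⟩
    choose y hyW hyx hyX using hy
    refine ⟨s.eval _ y, hs y hyW i hyX, ?_⟩
    rw [(isHom_fst A A).map_eval]
    exact congrArg _ (funext hyx)
  up := by
    rintro _ ⟨u, hu, rfl⟩ y hy h
    obtain ⟨v, hv, huv, rfl⟩ := exists_thin_lift hid hW (hX.subset hu) hy h
    exact ⟨v, hX.up u hu v hv huv, rfl⟩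

theorem AbsorbsUp.mem_of_maxIn_prod [Finite A.carrier] (hid : A.Idempotent)
    (hmf : A.MajorityFree) {W X : Set (A.prod A).carrier} (hW : (A.prod A).IsClosed W)
    (hX : (A.prod A).AbsorbsUp W X) {p : (A.prod A).carrier} (hp : (A.prod A).MaxIn W p) :
    p ∈ X := by
  obtain ⟨⟨a, b₁⟩, hb₁, ha⟩ := (hX.image_fst hid hW).mem_of_maxIn hid hmf
    ((isHom_fst A A).isClosed_image hW) (hp.image_fst hid hW)
  obtain ⟨a', b⟩ := p
  obtain rfl : a = a' := ha
  have hφ : A.IsHom (A.prod A) fun d => (a, d) := fun f x => Prod.ext (hid f a).symm rfl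
  obtain ⟨m, hbm, hm⟩ := exists_maxIn (P := A) (B := (fun d => (a, d)) ⁻¹' W) (x := b) hp.1
  have hmX := (hX.preimage hφ ⟨b₁, hb₁⟩).mem_of_maxIn hid hmf (hφ.isClosed_preimage hW) hm
  exact hX.reachIn hmX (hp.2 _ (hbm.map hφ (Set.mapsTo_preimage _ _)))

/-- The transpose of an element of `A × A`. -/
def transpose (u : (A.prod A).carrier) : (A.prod A).carrier := (u.2, u.1)

theorem isHom_transpose (A : UAlgebra σ) : (A.prod A).IsHom (A.prod A) transpose :=
  fun _ _ => rfl

@[simp]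
theorem transpose_transpose (u : (A.prod A).carrier) : transpose (transpose u) = u := rfl

/-- The subuniverse generated by a pair and its transpose. -/
def swapClosure (A : UAlgebra σ) (p : (A.prod A).carrier) : Set (A.prod A).carrier :=
  (A.prod A).ClosureSet {p, transpose p}

theorem swap_mem_swapClosure {p u : (A.prod A).carrier} (hu : u ∈ A.swapClosure p) :
    transpose u ∈ A.swapClosure p := by
  refine closureSet_subset ((isHom_transpose A).isClosed_preimage
    ((A.prod A).closureSet_isClosed {p, transpose p})) ?_ hu
  rintro _ (rfl | rfl)
  · exact subset_closureSet _ _ (.inr rfl)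
  · exact subset_closureSet _ _ (.inl (transpose_transpose p))

theorem exists_minimal_maxIn [Finite A.carrier] {D : Set (A.prod A).carrier}
    (hD : D.Nonempty) (hup : ∀ u ∈ D, ∀ v, (A.prod A).sReach u v → v ∈ D) :
    ∃ p ∈ D, (A.prod A).MaxIn (A.swapClosure p) p ∧
      ∀ u ∈ D, u ∈ A.swapClosure p → A.swapClosure u = A.swapClosure p := by
  obtain ⟨p, hpD, hmin⟩ := Set.exists_min_image D (fun u => (A.swapClosure u).ncard)
    (Set.toFinite _) hD
  have heq : ∀ u ∈ D, u ∈ A.swapClosure p → A.swapClosure u = A.swapClosure p :=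
    fun u huD hu => Set.eq_of_subset_of_ncard_le
      (closureSet_subset ((A.prod A).closureSet_isClosed _)
        (Set.pair_subset hu (swap_mem_swapClosure hu))) (hmin u huD) (Set.toFinite _)
  have hp : p ∈ A.swapClosure p := subset_closureSet _ _ (.inl rfl)
  obtain ⟨m, hpm, hm⟩ := exists_maxIn hp
  have hmD := hup p hpD m hpm.sReach
  have hmp := heq m hmD hm.1
  exact ⟨m, hmD, by rwa [hmp], fun u huD hu => (heq u huD (hmp ▸ hu)).trans hmp.symm⟩

theorem binaryAbsorptionFree_swapClosure [Finite A.carrier] (hid : A.Idempotent)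
    {p : (A.prod A).carrier}
    (hp : ∀ u, (A.prod A).IsThinSLEdge p u → u ∈ A.swapClosure p →
      A.swapClosure u = A.swapClosure p) :
    (A.prod A).BinaryAbsorptionFree (A.swapClosure p) := by
  intro Z hZW ⟨z, hz⟩ hZc u hu
  set Z' := Z ∩ transpose ⁻¹' Z with hZ'
  have hZ'c : (A.prod A).IsClosed Z' :=
    isClosed_inter hZc ((isHom_transpose A).isClosed_preimage hZc)
  have habs : ∀ x ∈ A.swapClosure p, ∀ z ∈ Z',
      u.eval _ ![x, z] ∈ Z' ∧ u.eval _ ![z, x] ∈ Z' := fun x hx z hz => by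
    have h := hu z hz.1 x hx
    have h' := hu _ hz.2 _ (swap_mem_swapClosure hx)
    refine ⟨⟨h.2, ?_⟩, ⟨h.1, ?_⟩⟩ <;> rw [Set.mem_preimage, (isHom_transpose A).map_eval_pair]
    exacts [h'.2, h'.1]
  have hz₀ : u.eval _ ![z, transpose z] ∈ Z' := by
    have h := hu z hz _ (swap_mem_swapClosure (hZW hz))
    refine ⟨h.1, ?_⟩
    rw [Set.mem_preimage, (isHom_transpose A).map_eval_pair, transpose_transpose]
    exact h.2
  have hpW : p ∈ A.swapClosure p := subset_closureSet _ _ (.inl rfl)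
  obtain ⟨e, he, heZ, -⟩ := exists_thinning (prod_idempotent hid hid) u
  have hmem := heZ p Z' (habs p hpW) (fun z hz z' hz' => hZ'c.eval_pair_mem u hz hz') _ hz₀
  refine hZW.antisymm ?_
  rw [← hp _ (he p _) (hZW hmem.1)]
  exact closureSet_subset hZc (Set.pair_subset hmem.1 hmem.2)

end Prod

section Transitive

variable {P : UAlgebra σ} {p q : P.carrier}

/-- The values at `(p, q, q)` of the ternary terms whose value at `(q, q, p)` is `p`. -/
def leftValues (P : UAlgebra σ) (p q : P.carrier) : Set P.carrier :=
  P.valuesAt ![p, q, q] (fun _ : Unit => ![q, q, p]) fun _ => {p}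

/-- The pairs of values of a ternary term at `(p, q, q)` and `(q, q, p)`. -/
def TripleLink (P : UAlgebra σ) (p q x z : P.carrier) : Prop :=
  ∃ s : Term σ 3, s.eval P ![p, q, q] = x ∧ s.eval P ![q, q, p] = z

theorem mem_leftValues {x : P.carrier} : x ∈ P.leftValues p q ↔ P.TripleLink p q x p :=
  ⟨fun ⟨s, h, h'⟩ => ⟨s, h, h' ()⟩, fun ⟨s, h, h'⟩ => ⟨s, h, fun _ => h'⟩⟩

theorem TripleLink.eval {n : ℕ} (t : Term σ n) {x z : Fin n → P.carrier}
    (h : ∀ i, P.TripleLink p q (x i) (z i)) : P.TripleLink p q (t.eval P x) (t.eval P z) := by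
  choose s hx hz using h
  exact ⟨t.subst s, by simp only [Term.eval_subst, hx], by simp only [Term.eval_subst, hz]⟩

theorem TripleLink.eval_pair (t : Term σ 2) {x x' z z' : P.carrier}
    (h : P.TripleLink p q x z) (h' : P.TripleLink p q x' z') :
    P.TripleLink p q (t.eval P ![x, x']) (t.eval P ![z, z']) :=
  TripleLink.eval t fun i => by fin_cases i <;> assumption

theorem tripleLink_right (hid : P.Idempotent) {x : P.carrier} (hx : x ∈ P.ClosureSet {p, q}) :
    P.TripleLink p q x q := by
  obtain ⟨u, rfl⟩ := mem_closureSet_pair.1 hx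
  refine ⟨u.comp₂ (.var 0) (.var 1), ?_, ?_⟩
  · simp [Term.eval]
  · simp [Term.eval, hid.eval_pair]

theorem TripleLink.of_mem_leftValues (hid : P.Idempotent) {x w : P.carrier}
    (hx : x ∈ P.leftValues p q) (hxW : x ∈ P.ClosureSet {p, q}) (hw : w ∈ P.ClosureSet {p, q}) :
    P.TripleLink p q x w := by
  obtain ⟨u, rfl⟩ := mem_closureSet_pair.1 hw
  have := (mem_leftValues.1 hx).eval_pair u (tripleLink_right hid hxW)
  rwa [hid.eval_pair] at this

theorem absorbsUp_leftValues [Finite P.carrier] (hid : P.Idempotent)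
    (ht : ∃ (n : ℕ) (t : Term σ n), ∀ i, p ∈ P.valuesThrough (P.ClosureSet {p, q}) q t i)
    (hup : ∀ e : Term σ 2, (∀ u v, P.IsThinSLEdge u (e.eval P ![u, v])) →
      p ∈ P.ClosureSet {e.eval P ![p, q], e.eval P ![q, p]}) :
    P.AbsorbsUp (P.ClosureSet {p, q}) (P.leftValues p q) := by
  have hsub : P.leftValues p q ⊆ P.ClosureSet {p, q} := by
    rintro _ ⟨s, rfl, -⟩
    refine (P.closureSet_isClosed _).eval_mem s fun i => subset_closureSet _ _ ?_
    fin_cases i <;> simp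
  refine ⟨hsub, ⟨q, mem_leftValues.2 ⟨.var 2, rfl, rfl⟩⟩,
    isClosed_valuesAt _ _ fun _ => hid.isClosed_singleton p, ?_, fun x hx y hy hxy => ?_⟩
  · obtain ⟨n, t, ht⟩ := ht
    refine ⟨n, t, fun x hx i hi => ?_⟩
    obtain ⟨v, hvW, hvi, hv⟩ := ht i
    suffices h : ∀ j, P.TripleLink p q (x j) (v j) by
      have := TripleLink.eval t h
      rwa [hv, ← mem_leftValues] at this
    intro j
    by_cases hj : j = i
    · rw [hj, hvi]
      exact tripleLink_right hid (hx i)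
    · exact .of_mem_leftValues hid (hi j hj) (hx j) (hvW j)
  · obtain ⟨e, he, h₁, h₂⟩ := hxy.exists_term hid
    obtain ⟨v, hv⟩ := mem_closureSet_pair.1 (hup e he)
    have hxp := mem_leftValues.1 hx
    have hyq := tripleLink_right hid hy
    have := (hxp.eval_pair e hyq).eval_pair v (hyq.eval_pair e hxp)
    rwa [h₁, h₂, hid.eval_pair, hv, ← mem_leftValues] at this

end Transitive

theorem IsMaxComponent.mem_of_sReach {A : UAlgebra σ} {C : Set A.carrier}
    (hC : A.IsMaxComponent C) {a c : A.carrier} (ha : a ∈ C) (h : A.sReach a c) : c ∈ C := by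
  obtain ⟨r, hr, rfl⟩ := hC
  exact ⟨ha.1.trans h, hr c (ha.1.trans h)⟩

theorem IsMaxComponent.nonempty {A : UAlgebra σ} {C : Set A.carrier}
    (hC : A.IsMaxComponent C) : C.Nonempty := by
  obtain ⟨r, hr, rfl⟩ := hC
  exact ⟨r, Relation.ReflTransGen.refl, Relation.ReflTransGen.refl⟩

theorem sReach_map {P Q : UAlgebra σ} {φ : P.carrier → Q.carrier} (hφ : P.IsHom Q φ)
    {x y : P.carrier} (h : P.sReach x y) : Q.sReach (φ x) (φ y) :=
  Relation.ReflTransGen.lift φ (fun _ _ h => h.map hφ) _ _ h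

/-- A pair `(a, b)` gives a Mal'tsev edge as soon as it arises from `(b, a)` by a ternary term
applied to `(a, b), (b, a), (b, a)` and to `(b, a), (b, a), (a, b)`. -/
theorem isMaltsevEdge_of_mem_leftValues {A : UAlgebra σ} (hid : A.Idempotent)
    {p : (A.prod A).carrier} (h : p ∈ (A.prod A).leftValues p (transpose p)) :
    A.IsMaltsevEdge p.1 p.2 := by
  obtain ⟨s, h₁, h₂⟩ := mem_leftValues.1 h
  have fst := fun x y z => (isHom_fst A A).map_eval_triple s x y z
  have snd := fun x y z => (isHom_snd A A).map_eval_triple s x y z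
  have e₁ := fst p (transpose p) (transpose p)
  have e₂ := snd p (transpose p) (transpose p)
  have e₃ := fst (transpose p) (transpose p) p
  have e₄ := snd (transpose p) (transpose p) p
  rw [h₁] at e₁ e₂
  rw [h₂] at e₃ e₄
  refine ⟨s, ?_⟩
  rintro x (rfl | rfl) y (rfl | rfl)
  exacts [⟨hid.eval_triple s _, hid.eval_triple s _⟩, ⟨e₁.symm, e₃.symm⟩,
    ⟨e₂.symm, e₄.symm⟩, ⟨hid.eval_triple s _, hid.eval_triple s _⟩]

end UAlgebra

/-- in a smooth majority free finite idempotent algebra omitting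
type 1, any two maximal components contain a Mal'tsev edge between them. -/
theorem stmt_12 (σ : Signature) (A : UAlgebra σ)
    (hfin : Finite A.carrier) (hne : Nonempty A.carrier) (hid : A.Idempotent)
    (hsm : A.IsSmooth) (h1 : A.OmitsType1) (hmf : A.MajorityFree)
    (C1 C2 : Set A.carrier) (hC1 : A.IsMaxComponent C1) (hC2 : A.IsMaxComponent C2) :
    ∃ a ∈ C1, ∃ b ∈ C2, A.IsMaltsevEdge a b := by
  have hidP := UAlgebra.prod_idempotent hid hid
  have hup : ∀ u : (A.prod A).carrier, u ∈ C1 ×ˢ C2 → ∀ v, (A.prod A).sReach u v →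
      v ∈ C1 ×ˢ C2 := fun u hu v huv =>
    ⟨hC1.mem_of_sReach hu.1 (UAlgebra.sReach_map (UAlgebra.isHom_fst A A) huv),
      hC2.mem_of_sReach hu.2 (UAlgebra.sReach_map (UAlgebra.isHom_snd A A) huv)⟩
  obtain ⟨p, hpD, hmax, hmin⟩ := UAlgebra.exists_minimal_maxIn
    (hC1.nonempty.prod hC2.nonempty) hup
  have hmin' : ∀ u, (A.prod A).IsThinSLEdge p u → u ∈ A.swapClosure p →
      A.swapClosure u = A.swapClosure p := fun u hpu hu =>
    hmin u (hup p hpD u (.single hpu)) hu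
  have hWc : (A.prod A).IsClosed (A.swapClosure p) := (A.prod A).closureSet_isClosed _
  have hpW := hmax.1
  have hqW := UAlgebra.swap_mem_swapClosure hpW
  have htrans := UAlgebra.exists_transitive_term (q := UAlgebra.transpose p) hidP hWc
    (fun Z hZW hZ hne => (UAlgebra.binaryAbsorptionFree_swapClosure hid hmin').exists_moves hid h1
      (h := fun k : Bool => if k then Prod.fst else Prod.snd)
      (fun k => by cases k; exacts [UAlgebra.isHom_snd A A, UAlgebra.isHom_fst A A])
      (fun x y hxy => Prod.ext (hxy true) (hxy false)) hWc hZW hZ hne) hpW hqW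
  refine ⟨p.1, hpD.1, p.2, hpD.2, UAlgebra.isMaltsevEdge_of_mem_leftValues hid ?_⟩
  refine (UAlgebra.absorbsUp_leftValues hidP htrans fun e he => ?_).mem_of_maxIn_prod hid hmf
    hWc hmax
  have heq := hmin' _ (he p (UAlgebra.transpose p)) (hWc.eval_pair_mem e hpW hqW)
  have hswap : UAlgebra.transpose (e.eval (A.prod A) ![p, UAlgebra.transpose p]) =
      e.eval _ ![UAlgebra.transpose p, p] := by
    rw [(UAlgebra.isHom_transpose A).map_eval_pair, UAlgebra.transpose_transpose]
  rw [UAlgebra.swapClosure, hswap] at heq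
  rw [heq]
  exact hpW
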